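/- Let F = ℚ(√d) with d ≥ 6 squarefree, assume Nm_{F/ℚ}(ε) = 1, let H = (−ε,−3/F), and let 𝒪₃‡ = O_F[i, (1+j)/2] (the O_F-order with O_F-basis 1, i, (1+j)/2, (i+k)/2). If 3 ∣ d, let 𝔮 be the unique prime of O_F above 3. Then the pair (ℵ(𝒪₃‡), ℶ(𝒪₃‡)) equals: (1,1) if 3 ∣ d and ε ≡ 1 (mod 𝔮); (3,2) if 3 ∣ d and ε ≡ −1 (mod 𝔮); (1,1) if d ≡ 1 (mod 3) and ε ≡ 1 (mod 3O_F); (4,2) if d ≡ 1 (mod 3) and ε ≡ −1 (mod 3O_F); and (2,1) if d ≡ 2 (mod 3). -/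

import Mathlib

open NumberField Quaternion

noncomputable section

namespace QuatPaper

variable (F : Type) [Field F] [NumberField F]

def scalarSet (H : Type) [Ring H] [Algebra F H] : Set H :=
  Set.range fun r : 𝓞 F => algebraMap F H (algebraMap (𝓞 F) F r)

def IsOrder {H : Type} [Ring H] [Algebra F H] (O : Subring H) : Prop :=
  scalarSet F H ⊆ ↑O ∧ O.toAddSubgroup.FG ∧ Submodule.span F (O : Set H) = ⊤

def IsMaximalOrder {H : Type} [Ring H] [Algebra F H] (O : Subring H) : Prop :=
  IsOrder F O ∧ ∀ O' : Subring H, IsOrder F O' → O ≤ O' → O' = O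

def IsScalarUnit {H : Type} [Ring H] [Algebra F H] {O : Subring H} (u : (↥O)ˣ) : Prop :=
  ∃ r : (𝓞 F)ˣ, ((u : ↥O) : H) = algebraMap F H (algebraMap (𝓞 F) F ↑r)

def RedUnitIso {H : Type} [Ring H] [Algebra F H] (O : Subring H) (G : Type*) [Group G] : Prop :=
  ∃ φ : (↥O)ˣ →* G, Function.Surjective φ ∧ ∀ u, φ u = 1 ↔ IsScalarUnit F u

def IsConjugate {H : Type} [Ring H] (x : Hˣ) (O O' : Subring H) : Prop :=
  ∀ y : H, y ∈ O ↔ (x : H) * y * ((x⁻¹ : Hˣ) : H) ∈ O'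

def ConjRel {H : Type} [Ring H] (O O' : Subring H) : Prop :=
  ∃ x : Hˣ, IsConjugate x O O'

def typeNum (H : Type) [Ring H] [Algebra F H] (G : Type*) [Group G] : ℕ :=
  Nat.card (Quot fun O O' : {O : Subring H // IsMaximalOrder F O ∧ RedUnitIso F O G} =>
    ConjRel O.1 O'.1)

def IsQuatAlg (H : Type) [Ring H] [Algebra F H] : Prop :=
  ∃ a b : F, a ≠ 0 ∧ b ≠ 0 ∧ Nonempty (H ≃ₐ[F] ℍ[F, a, b])

def TotallyDefinite (H : Type) [Ring H] [Algebra F H] : Prop :=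
  ∀ σ : F →+* ℝ,
    letI : Algebra F ℝ := σ.toAlgebra
    ∀ x : TensorProduct F ℝ H, x ≠ 0 → IsUnit x

/-- The reduced norm `Nr(x) = x·x̄` of a quaternion `x ∈ ℍ[F, A, B]`. -/
def redNorm {A B : F} (x : ℍ[F, A, B]) : F := (x * star x).re

/-- The reduced unit group of `O` is isomorphic to the dihedral group `D_n` and is
of the *first kind*: every element of order `2` in `O^×/O_F^×` admits a representative
whose reduced norm is the square of a unit of `O_F`. -/
def RedUnitDihedralFirstKind {A B : F} (n : ℕ) (O : Subring ℍ[F, A, B]) : Prop :=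
  ∃ φ : (↥O)ˣ →* DihedralGroup n, Function.Surjective φ ∧
    (∀ u, φ u = 1 ↔ IsScalarUnit F u) ∧
    ∀ u : (↥O)ˣ, φ u ≠ 1 → φ u * φ u = 1 →
      ∃ u' : (↥O)ˣ, φ u' = φ u ∧ ∃ r : (𝓞 F)ˣ,
        redNorm F ((u' : ↥O) : ℍ[F, A, B]) = algebraMap (𝓞 F) F ↑r ^ 2

/-- The reduced unit group of `O` is isomorphic to the dihedral group `D_n` and is
of the *second kind*: some element of order `2` in `O^×/O_F^×` has no representative
whose reduced norm is the square of a unit of `O_F`. -/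
def RedUnitDihedralSecondKind {A B : F} (n : ℕ) (O : Subring ℍ[F, A, B]) : Prop :=
  ∃ φ : (↥O)ˣ →* DihedralGroup n, Function.Surjective φ ∧
    (∀ u, φ u = 1 ↔ IsScalarUnit F u) ∧
    ∃ u : (↥O)ˣ, φ u ≠ 1 ∧ φ u * φ u = 1 ∧
      ∀ u' : (↥O)ˣ, φ u' = φ u → ∀ r : (𝓞 F)ˣ,
        redNorm F ((u' : ↥O) : ℍ[F, A, B]) ≠ algebraMap (𝓞 F) F ↑r ^ 2

/-- `t(H, D_n†)`: the number of conjugacy classes of maximal orders whose reduced unit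
group is isomorphic to `D_n` of the first kind. -/
def typeNumDnFirstKind (A B : F) (n : ℕ) : ℕ :=
  Nat.card (Quot fun O O' : {O : Subring ℍ[F, A, B] //
      IsMaximalOrder F O ∧ RedUnitDihedralFirstKind F n O} => ConjRel O.1 O'.1)

/-- `t(H, D_n‡)`: the number of conjugacy classes of maximal orders whose reduced unit
group is isomorphic to `D_n` of the second kind. -/
def typeNumDnSecondKind (A B : F) (n : ℕ) : ℕ :=
  Nat.card (Quot fun O O' : {O : Subring ℍ[F, A, B] //
      IsMaximalOrder F O ∧ RedUnitDihedralSecondKind F n O} => ConjRel O.1 O'.1)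

/-- `ℵ(O₀)`: the number of maximal orders containing `O₀`. -/
def alephNum {H : Type} [Ring H] [Algebra F H] (O₀ : Subring H) : ℕ :=
  Nat.card {O : Subring H // IsMaximalOrder F O ∧ O₀ ≤ O}

/-- `ℶ(O₀)`: the number of orbits of the conjugation action of the normalizer
`N(O₀)` on the set of maximal orders containing `O₀`. -/
def bethNum {H : Type} [Ring H] [Algebra F H] (O₀ : Subring H) : ℕ :=
  Nat.card (Quot fun O O' : {O : Subring H // IsMaximalOrder F O ∧ O₀ ≤ O} =>
    ∃ x : Hˣ, IsConjugate x O₀ O₀ ∧ IsConjugate x O.1 O'.1)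

section Integrality

variable {K : Type} [Field K] {A B : K}

lemma isIntegral_star {x : ℍ[K, A, B]} (hx : IsIntegral ℤ x) : IsIntegral ℤ (star x) := by
  obtain ⟨p, hp, h0⟩ := hx
  refine ⟨p, hp, ?_⟩
  have h := congrArg star h0
  rw [Polynomial.eval₂_eq_sum_range, star_sum, star_zero] at h
  rw [Polynomial.eval₂_eq_sum_range, ← h]
  refine Finset.sum_congr rfl fun i _ => ?_
  rw [star_mul, star_pow, eq_intCast, star_intCast]
  exact Int.cast_commute _ _

open scoped IsMulCommutative in
lemma isIntegral_add_mul_star {x : ℍ[K, A, B]} (hx : IsIntegral ℤ x) :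
    IsIntegral ℤ (x + star x) ∧ IsIntegral ℤ (x * star x) := by
  have hcomm : ∀ a ∈ ({x, star x} : Set ℍ[K, A, B]), ∀ b ∈ ({x, star x} : Set ℍ[K, A, B]),
      a * b = b * a := by
    have h : x * star x = star x * x := (QuaternionAlgebra.instIsStarNormal x).star_comm_self.symm
    rintro a (rfl | rfl) b (rfl | rfl) <;> first | rfl | exact h | exact h.symm
  let S := Algebra.adjoin ℤ ({x, star x} : Set ℍ[K, A, B])
  have : IsMulCommutative S := Algebra.isMulCommutative_adjoin ℤ hcomm
  let a : S := ⟨x, Algebra.subset_adjoin (by simp)⟩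
  let b : S := ⟨star x, Algebra.subset_adjoin (by simp)⟩
  have ha : IsIntegral ℤ a := (isIntegral_algHom_iff S.val Subtype.val_injective).1 hx
  have hb : IsIntegral ℤ b :=
    (isIntegral_algHom_iff S.val Subtype.val_injective).1 (isIntegral_star hx)
  exact ⟨(ha.add hb).map S.val, (ha.mul hb).map S.val⟩

lemma isIntegral_of_coe {r : K} (h : IsIntegral ℤ (algebraMap K ℍ[K, A, B] r)) :
    IsIntegral ℤ r :=
  (isIntegral_algHom_iff ((Algebra.ofId K ℍ[K, A, B]).restrictScalars ℤ)
    (FaithfulSMul.algebraMap_injective K ℍ[K, A, B])).1 h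

lemma isIntegral_of_mem_subring {H : Type} [Ring H] {O : Subring H}
    (hfg : O.toAddSubgroup.FG) {x : H} (hx : x ∈ O) : IsIntegral ℤ x := by
  refine IsIntegral.of_mem_of_fg (subalgebraOfSubring O) ?_ x hx
  rw [Submodule.fg_iff_addSubgroup_fg]
  exact hfg

/-- Elements of a finitely generated subring have integral reduced trace and norm. -/
lemma exists_trace_norm {O : Subring ℍ[K, A, B]} (hfg : O.toAddSubgroup.FG)
    {x : ℍ[K, A, B]} (hx : x ∈ O) :
    (∃ t : 𝓞 K, (t : K) = 2 * x.re) ∧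
    ∃ n : 𝓞 K, (n : K) = x.re ^ 2 - A * x.imI ^ 2 - B * x.imJ ^ 2 + A * B * x.imK ^ 2 := by
  obtain ⟨h1, h2⟩ := isIntegral_add_mul_star (isIntegral_of_mem_subring hfg hx)
  have ht : IsIntegral ℤ (2 * x.re) := by
    refine isIntegral_of_coe (A := A) (B := B) ?_
    convert h1 using 1
    rw [two_mul, map_add]
    ext <;> simp
  have hn : IsIntegral ℤ (x.re ^ 2 - A * x.imI ^ 2 - B * x.imJ ^ 2 + A * B * x.imK ^ 2) := by
    refine isIntegral_of_coe (A := A) (B := B) ?_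
    convert h2 using 1
    ext <;> simp [sq] <;> ring
  exact ⟨⟨⟨_, ht⟩, rfl⟩, ⟨⟨_, hn⟩, rfl⟩⟩

end Integrality

section RealQuadratic

/-- `F` is the real quadratic field generated by `sqrtd`, a square root of the
squarefree integer `d ≥ 6`. -/
structure IsRealQuadratic (K : Type) [Field K] [CharZero K] (d : ℕ) (sqrtd : K) : Prop where
  six_le : 6 ≤ d
  squarefree : Squarefree d
  sq_eq : sqrtd ^ 2 = d
  adjoin_eq_top : Algebra.adjoin ℚ {sqrtd} = ⊤

namespace IsRealQuadratic

variable {K : Type} [Field K] [NumberField K] {d : ℕ} {sqrtd : K}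

lemma not_isSquare (h : IsRealQuadratic K d sqrtd) : ¬IsSquare d := by
  rintro ⟨m, hm⟩
  have h1 := h.squarefree m (hm ▸ dvd_rfl)
  rw [Nat.isUnit_iff] at h1
  have := h.six_le
  subst h1
  omega

lemma rat_eq_zero (h : IsRealQuadratic K d sqrtd) {p q : ℚ} (hpq : p ^ 2 = d * q ^ 2) :
    p = 0 ∧ q = 0 := by
  by_cases hq : q = 0
  · subst hq
    simpa using hpq
  · refine absurd ?_ h.not_isSquare
    rw [← Rat.isSquare_natCast_iff]
    exact ⟨p / q, by field_simp; linarith⟩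

lemma exists_rat (h : IsRealQuadratic K d sqrtd) (x : K) :
    ∃ p q : ℚ, x = p + q * sqrtd := by
  have hx : x ∈ Algebra.adjoin ℚ {sqrtd} := h.adjoin_eq_top ▸ Algebra.mem_top
  induction hx using Algebra.adjoin_induction with
  | mem y hy => exact ⟨0, 1, by simp_all⟩
  | algebraMap r => exact ⟨r, 0, by simp⟩
  | add y z _ _ hy hz =>
    obtain ⟨p, q, rfl⟩ := hy
    obtain ⟨p', q', rfl⟩ := hz
    exact ⟨p + p', q + q', by push_cast; ring⟩
  | mul y z _ _ hy hz =>
    obtain ⟨p, q, rfl⟩ := hy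
    obtain ⟨p', q', rfl⟩ := hz
    refine ⟨p * p' + d * (q * q'), p * q' + q * p', ?_⟩
    push_cast
    linear_combination (q * q' : K) * h.sq_eq

lemma rat_ext (h : IsRealQuadratic K d sqrtd) {p q p' q' : ℚ}
    (heq : (p + q * sqrtd : K) = p' + q' * sqrtd) : p = p' ∧ q = q' := by
  have key : (p - p') ^ 2 = d * (q - q') ^ 2 := by
    have : ((p - p' : ℚ) : K) ^ 2 = d * ((q - q' : ℚ) : K) ^ 2 := by
      rw [← h.sq_eq]
      push_cast
      linear_combination (p - p' - (q - q') * sqrtd : K) * heq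
    exact_mod_cast this
  obtain ⟨h1, h2⟩ := h.rat_eq_zero key
  exact ⟨sub_eq_zero.1 h1, sub_eq_zero.1 h2⟩

lemma int_ext (h : IsRealQuadratic K d sqrtd) {m n m' n' : ℤ}
    (heq : (m + n * sqrtd : K) = m' + n' * sqrtd) : m = m' ∧ n = n' := by
  have := h.rat_ext (p := m) (q := n) (p' := m') (q' := n') (by push_cast; exact heq)
  exact_mod_cast this

/-- The identification of a quadratic field with the quadratic algebra `ℚ[√d]`. -/
lemma exists_algEquiv (h : IsRealQuadratic K d sqrtd) :
    ∃ φ : QuadraticAlgebra ℚ (d : ℚ) 0 ≃ₐ[ℚ] K, ∀ z, φ z = z.re + z.im * sqrtd := by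
  let f : QuadraticAlgebra ℚ (d : ℚ) 0 →ₐ[ℚ] K := QuadraticAlgebra.lift
    ⟨sqrtd, by rw [zero_smul, add_zero, ← sq, h.sq_eq, Rat.smul_def]; simp⟩
  have hf : ∀ z, f z = z.re + z.im * sqrtd := fun z => by
    simp [f, Rat.smul_def]
  refine ⟨AlgEquiv.ofBijective f ⟨fun z w hzw => ?_, fun x => ?_⟩, hf⟩
  · rw [hf, hf] at hzw
    obtain ⟨h1, h2⟩ := h.rat_ext hzw
    exact QuadraticAlgebra.ext h1 h2
  · obtain ⟨p, q, rfl⟩ := h.exists_rat x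
    exact ⟨⟨p, q⟩, hf _⟩

lemma norm_eq (h : IsRealQuadratic K d sqrtd) (p q : ℚ) :
    Algebra.norm ℚ (p + q * sqrtd : K) = p ^ 2 - d * q ^ 2 := by
  obtain ⟨φ, hφ⟩ := h.exists_algEquiv
  have h1 := hφ ⟨p, q⟩
  simp only at h1
  rw [← h1, Algebra.norm_eq_of_algEquiv]
  have h2 := QuadraticAlgebra.det_toLinearMap_eq_norm (⟨p, q⟩ : QuadraticAlgebra ℚ (d : ℚ) 0)
  rw [Algebra.norm_apply]
  refine Eq.trans ?_ (h2.trans ?_)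
  · rfl
  · simp [QuadraticAlgebra.norm_def]
    ring

lemma exists_conj (h : IsRealQuadratic K d sqrtd) (σ₀ : K →+* ℝ) :
    ∃ σ₁ : K →+* ℝ, σ₁ sqrtd = -σ₀ sqrtd := by
  obtain ⟨φ, hφ⟩ := h.exists_algEquiv
  have hs : -σ₀ sqrtd * -σ₀ sqrtd = (d : ℚ) • (1 : ℝ) + (0 : ℚ) • -σ₀ sqrtd := by
    have := congrArg σ₀ h.sq_eq
    rw [map_pow, map_natCast] at this
    rw [neg_mul_neg, ← sq, this, zero_smul, add_zero, Rat.smul_def]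
    simp
  refine ⟨((QuadraticAlgebra.lift ⟨_, hs⟩).comp φ.symm.toAlgHom).toRingHom, ?_⟩
  have h1 : φ.symm sqrtd = ⟨0, 1⟩ := by
    rw [AlgEquiv.symm_apply_eq, hφ]
    simp
  simp [h1]

lemma isIntegral_rat {p : ℚ} (hp : IsIntegral ℤ (p : ℝ)) : ∃ m : ℤ, p = m := by
  have h1 : IsIntegral ℤ p :=
    (isIntegral_algHom_iff ((Algebra.ofId ℚ ℝ).restrictScalars ℤ) Rat.cast_injective).1 hp
  obtain ⟨m, hm⟩ := IsIntegrallyClosed.isIntegral_iff.1 h1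
  exact ⟨m, by simpa using hm.symm⟩

/-- Elements of the ring of integers have half-integral coordinates. -/
lemma exists_int (h : IsRealQuadratic K d sqrtd) (σ₀ : K →+* ℝ) (r : 𝓞 K) :
    ∃ m n N : ℤ, (2 * r : K) = m + n * sqrtd ∧ m ^ 2 - d * n ^ 2 = 4 * N := by
  obtain ⟨σ₁, hσ₁⟩ := h.exists_conj σ₀
  obtain ⟨p, q, hr⟩ := h.exists_rat (r : K)
  have hsq : σ₀ sqrtd ^ 2 = d := by rw [← map_pow, h.sq_eq, map_natCast]
  have hi : ∀ σ : K →+* ℝ, IsIntegral ℤ (σ r) := fun σ =>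
    (RingOfIntegers.isIntegral_coe r).map (σ.toIntAlgHom)
  have e0 : σ₀ r = p + q * σ₀ sqrtd := by simp [hr]
  have e1 : σ₁ r = p - q * σ₀ sqrtd := by simp [hr, hσ₁, sub_eq_add_neg]
  obtain ⟨m, hm⟩ := isIntegral_rat (p := 2 * p) (by
    refine (congrArg (IsIntegral ℤ) ?_).mp ((hi σ₀).add (hi σ₁))
    rw [e0, e1]; push_cast; ring)
  obtain ⟨N, hN⟩ := isIntegral_rat (p := p ^ 2 - d * q ^ 2) (by
    refine (congrArg (IsIntegral ℤ) ?_).mp ((hi σ₀).mul (hi σ₁))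
    rw [e0, e1]; push_cast; linear_combination (-(q : ℝ) ^ 2) * hsq)
  have hw : (2 * q) ^ 2 * d = (m ^ 2 - 4 * N : ℤ) := by
    push_cast
    rw [← hm, ← hN]
    ring
  obtain ⟨n, hn⟩ : ∃ n : ℤ, 2 * q = n := by
    refine ⟨(2 * q).num, ?_⟩
    generalize 2 * q = w at hw ⊢
    generalize m ^ 2 - 4 * N = k at hw
    have h1 : w.num ^ 2 * (d : ℤ) = k * (w.den : ℤ) ^ 2 := by
      have h3 : (w.den : ℚ) ≠ 0 := by exact_mod_cast w.den_nz
      have h2 : ((w.num : ℚ) / w.den) ^ 2 * d = k := by rw [Rat.num_div_den]; exact hw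
      field_simp at h2
      have h4 : (w.num : ℚ) ^ 2 * d = k * (w.den : ℚ) ^ 2 := by linarith
      exact_mod_cast h4
    have h2 : (w.den : ℤ) ^ 2 ∣ d := by
      refine IsCoprime.dvd_of_dvd_mul_left (y := w.num ^ 2) ?_
        ⟨k, by rw [h1]; ring⟩
      exact (Int.isCoprime_iff_nat_coprime.2 (by simpa using w.reduced)).symm.pow
    have h3 : w.den * w.den ∣ d := by
      rw [← sq]; exact_mod_cast h2
    have h4 := Nat.isUnit_iff.1 (h.squarefree _ h3)
    exact (Rat.coe_int_num_of_den_eq_one h4).symm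
  refine ⟨m, n, N, ?_, ?_⟩
  · rw [hr, ← Rat.cast_intCast (α := K) m, ← Rat.cast_intCast (α := K) n, ← hm, ← hn]
    push_cast
    ring
  · have : (m : ℚ) ^ 2 - d * n ^ 2 = 4 * N := by
      rw [← hm, ← hn, ← hN]; ring
    exact_mod_cast this

/-- An algebraic integer of `K` all of whose conjugates lie in `[-2, 2]` is rational. -/
lemma exists_int_of_sq_le (h : IsRealQuadratic K d sqrtd) {σ₀ σ₁ : K →+* ℝ}
    (hσ₁ : σ₁ sqrtd = -σ₀ sqrtd) (r : 𝓞 K)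
    (h0 : σ₀ r ^ 2 ≤ 4) (h1 : σ₁ r ^ 2 ≤ 4) : ∃ k : ℤ, r = k ∧ k ^ 2 ≤ 4 := by
  obtain ⟨m, n, N, hmn, hN⟩ := h.exists_int σ₀ r
  set s := σ₀ sqrtd with hs
  have hsq : s ^ 2 = d := by rw [hs, ← map_pow, h.sq_eq, map_natCast]
  have e0 : 2 * σ₀ r = m + n * s := by
    rw [← map_ofNat σ₀ 2, ← map_mul, hmn]
    simp [hs]
  have e1 : 2 * σ₁ r = m - n * s := by
    rw [← map_ofNat σ₁ 2, ← map_mul, hmn]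
    simp [hσ₁, hs, sub_eq_add_neg]
  have b0 : (m + n * s) ^ 2 ≤ 16 := by rw [← e0]; linarith
  have b1 : (m - n * s) ^ 2 ≤ 16 := by rw [← e1]; linarith
  have hd6 := h.six_le
  have hsum : m ^ 2 + d * n ^ 2 ≤ 16 := by
    have : (m : ℝ) ^ 2 + d * n ^ 2 ≤ 16 := by rw [← hsq]; linarith
    exact_mod_cast this
  have hsumd : (d : ℤ) * n ^ 2 ≤ 16 := by nlinarith [sq_nonneg m]
  have hn : n = 0 := by
    by_contra hn
    have hn2 : 1 ≤ n ^ 2 := by have := sq_pos_of_ne_zero hn; omega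
    have hd6' : (6 : ℤ) ≤ d := by exact_mod_cast hd6
    have hn1 : n ^ 2 = 1 := by
      have : n ^ 2 < 3 := by nlinarith
      have h5 : n < 2 := by nlinarith
      have h6 : -2 < n := by nlinarith
      interval_cases n <;> simp_all
    have hd16 : d ≤ 16 := by
      rw [hn1] at hsumd
      omega
    rw [hn1, mul_one] at hN hsum
    have hprod : 4 * (m ^ 2 * d) ≤ (16 - m ^ 2 - d : ℤ) ^ 2 := by
      have hn1' : (n : ℝ) ^ 2 = 1 := by exact_mod_cast hn1
      have hsum' : (m : ℝ) ^ 2 + d ≤ 16 := by exact_mod_cast hsum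
      have e2 : ((m * n * s) * 2) ^ 2 = 4 * ((m : ℝ) ^ 2 * d) := by
        linear_combination (4 * (m : ℝ) ^ 2 * s ^ 2) * hn1' + 4 * (m : ℝ) ^ 2 * hsq
      have e3 : ((m * n * s) * 2) ^ 2 ≤ (16 - (m : ℝ) ^ 2 - d) ^ 2 := by
        apply sq_le_sq'
        · nlinarith
        · nlinarith
      rw [e2] at e3
      exact_mod_cast e3
    have hsf := h.squarefree
    have h4 : ¬ 4 ∣ d := fun h4 => by
      have := Nat.isUnit_iff.1 (hsf 2 h4)
      omega
    have h9 : d ≠ 9 := by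
      rintro rfl
      have := Nat.isUnit_iff.1 (hsf 3 (by norm_num))
      omega
    have h5 : m < 4 := by nlinarith
    have h6 : -4 < m := by nlinarith
    interval_cases d <;> interval_cases m <;> omega
  subst hn
  have hm : m ^ 2 = 4 * N := by simpa using hN
  obtain ⟨k, rfl⟩ : 2 ∣ m := Int.prime_two.dvd_of_dvd_pow (n := 2) ⟨2 * N, by rw [hm]; ring⟩
  refine ⟨k, ?_, by nlinarith⟩
  have : (2 : K) * r = 2 * k := by simpa using hmn
  apply RingOfIntegers.ext
  simpa using mul_left_cancel₀ two_ne_zero this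

end IsRealQuadratic

end RealQuadratic

section Reduction

namespace IsRealQuadratic

variable {K : Type} [Field K] [NumberField K] {d : ℕ} {sqrtd : K}

lemma exists_sqrt (h : IsRealQuadratic K d sqrtd) : ∃ s : 𝓞 K, (s : K) = sqrtd :=
  ⟨⟨sqrtd, IsIntegral.of_pow two_pos (h.sq_eq ▸ isIntegral_natCast _)⟩, rfl⟩

/-- Reduction modulo `3`, with values in the explicit ring `(ℤ/3)[√d]`. -/
lemma exists_reduction (h : IsRealQuadratic K d sqrtd) (σ₀ : K →+* ℝ) :
    ∃ π : 𝓞 K →+* QuadraticAlgebra (ZMod 3) (d : ZMod 3) 0,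
      (∀ (r : 𝓞 K) (m n : ℤ), (2 * r : K) = m + n * sqrtd → π r = ⟨2 * m, 2 * n⟩) ∧
      Function.Surjective π ∧ ∀ r, π r = 0 ↔ (3 : 𝓞 K) ∣ r := by
  choose m n N hmn hN using h.exists_int σ₀
  have key : ∀ (r : 𝓞 K) (m' n' : ℤ), (2 * r : K) = m' + n' * sqrtd → m r = m' ∧ n r = n' :=
    fun r m' n' hr => h.int_ext (by rw [← hmn, hr])
  have h4 : (4 : ZMod 3) = 1 := rfl
  have h3 : (3 : ZMod 3) = 0 := rfl
  let π : 𝓞 K →+* QuadraticAlgebra (ZMod 3) (d : ZMod 3) 0 :=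
    { toFun r := ⟨2 * m r, 2 * n r⟩
      map_one' := by
        obtain ⟨h1, h2⟩ := key 1 2 0 (by simp)
        rw [h1, h2]
        ext <;> simp [QuadraticAlgebra.re_one, QuadraticAlgebra.im_one]
        rfl
      map_zero' := by
        obtain ⟨h1, h2⟩ := key 0 0 0 (by simp)
        rw [h1, h2]
        ext <;> simp
      map_add' r r' := by
        obtain ⟨h1, h2⟩ := key (r + r') (m r + m r') (n r + n r') (by
          push_cast
          linear_combination hmn r + hmn r')
        rw [h1, h2]
        ext <;> simp <;> ring
      map_mul' r r' := by
        have e : (2 * ((m (r * r') : ℤ) + (n (r * r') : ℤ) * sqrtd) : K) =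
            (m r * m r' + d * (n r * n r') : ℤ) + (m r * n r' + n r * m r' : ℤ) * sqrtd := by
          rw [← hmn]
          have e1 := hmn r
          have e2 := hmn r'
          push_cast
          linear_combination (2 * r' : K) * e1 + (m r + n r * sqrtd) * e2 +
            (n r * n r' : K) * h.sq_eq
        obtain ⟨h1, h2⟩ := h.int_ext (m := 2 * m (r * r')) (n := 2 * n (r * r'))
          (by rw [← e]; push_cast; ring)
        have h1' := congrArg (Int.cast : ℤ → ZMod 3) h1
        have h2' := congrArg (Int.cast : ℤ → ZMod 3) h2
        push_cast at h1' h2'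
        ext
        · simp only [QuadraticAlgebra.re_mul]
          linear_combination h1' - (m r * m r' + d * (n r * n r') : ZMod 3) * h3
        · simp only [QuadraticAlgebra.im_mul]
          linear_combination h2' - (m r * n r' + n r * m r' : ZMod 3) * h3 }
  have hπ : ∀ (r : 𝓞 K) (m n : ℤ), (2 * r : K) = m + n * sqrtd → π r = ⟨2 * m, 2 * n⟩ := by
    intro r m' n' hr
    obtain ⟨h1, h2⟩ := key r m' n' hr
    rw [← h1, ← h2]
    rfl
  obtain ⟨s, hs⟩ := h.exists_sqrt
  refine ⟨π, hπ, fun x => ⟨x.re.val + x.im.val * s, ?_⟩, fun r => ⟨fun hr => ?_, ?_⟩⟩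
  · rw [hπ _ (2 * x.re.val) (2 * x.im.val) (by push_cast [hs]; ring)]
    ext
    · push_cast
      rw [ZMod.natCast_zmod_val]
      linear_combination x.re * h3
    · push_cast
      rw [ZMod.natCast_zmod_val]
      linear_combination x.im * h3
  · have hm : ((m r : ℤ) : ZMod 3) = 0 := by
      have : (2 * m r : ZMod 3) = 0 := congrArg QuadraticAlgebra.re hr
      linear_combination 2 * this - (m r : ZMod 3) * h3
    have hn : ((n r : ℤ) : ZMod 3) = 0 := by
      have : (2 * n r : ZMod 3) = 0 := congrArg QuadraticAlgebra.im hr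
      linear_combination 2 * this - (n r : ZMod 3) * h3
    obtain ⟨m', hm'⟩ := (ZMod.intCast_zmod_eq_zero_iff_dvd _ 3).1 hm
    obtain ⟨n', hn'⟩ := (ZMod.intCast_zmod_eq_zero_iff_dvd _ 3).1 hn
    refine ⟨r - m' - n' * s, ?_⟩
    have := hmn r
    rw [hm', hn'] at this
    apply RingOfIntegers.ext
    simp only [map_mul, map_sub, map_ofNat, map_intCast, hs]
    push_cast at this
    linear_combination (-1 : K) * this
  · rintro ⟨t, rfl⟩
    rw [map_mul, map_ofNat]
    have : (3 : QuadraticAlgebra (ZMod 3) (d : ZMod 3) 0) = 0 := rfl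
    rw [this, zero_mul]

end IsRealQuadratic

end Reduction

section OverOrders

lemma coe_two {K : Type*} [Field K] : ((2 : 𝓞 K) : K) = 2 := map_ofNat (algebraMap (𝓞 K) K) 2

lemma coe_three {K : Type*} [Field K] : ((3 : 𝓞 K) : K) = 3 := map_ofNat (algebraMap (𝓞 K) K) 3

lemma zero_mk_mem {L : Type*} [CommRing L] (P : Submodule L (L × L)) : ((0 : L), (0 : L)) ∈ P :=
  P.zero_mem

variable {K : Type} [Field K] [NumberField K]

/-- The quaternion algebra `(-ε, -3 / K)`. -/
abbrev QuatOfUnit (ε : (𝓞 K)ˣ) : Type := ℍ[K, -(algebraMap (𝓞 K) K ↑ε), -3]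

/-- The order `𝒪₃‡ = O_K[i, (1 + j) / 2]`. -/
abbrev baseOrder (ε : (𝓞 K)ˣ) : Subring (QuatOfUnit ε) :=
  Subring.closure (scalarSet K (QuatOfUnit ε) ∪
    {⟨0, 1, 0, 0⟩, (2 : K)⁻¹ • (1 + (⟨0, 0, 1, 0⟩ : QuatOfUnit ε))})

/-- The element `m (1 + j) / 2 + n i (1 + j) / 2 + (a j + b k) / 3`. -/
def elt (ε : (𝓞 K)ˣ) (m n a b : 𝓞 K) : QuatOfUnit ε :=
  ⟨m / 2, n / 2, m / 2 + a / 3, n / 2 + b / 3⟩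

lemma elt_injective {ε : (𝓞 K)ˣ} {m n a b m' n' a' b' : 𝓞 K}
    (h : elt ε m n a b = elt ε m' n' a' b') : m = m' ∧ n = n' ∧ a = a' ∧ b = b' := by
  simp only [elt, QuaternionAlgebra.mk.injEq] at h
  obtain ⟨h0, h1, h2, h3⟩ := h
  rw [h0, add_right_inj] at h2
  rw [h1, add_right_inj] at h3
  have h2' : (2 : K) ≠ 0 := two_ne_zero
  have h3' : (3 : K) ≠ 0 := three_ne_zero
  rw [div_left_inj' h2'] at h0 h1
  rw [div_left_inj' h3'] at h2 h3
  exact ⟨RingOfIntegers.ext h0, RingOfIntegers.ext h1, RingOfIntegers.ext h2,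
    RingOfIntegers.ext h3⟩

lemma elt_add (ε : (𝓞 K)ˣ) (m n a b m' n' a' b' : 𝓞 K) :
    elt ε m n a b + elt ε m' n' a' b' = elt ε (m + m') (n + n') (a + a') (b + b') := by
  ext <;> simp [elt] <;> ring

lemma elt_mul (ε : (𝓞 K)ˣ) {m n a b p q c f S D : 𝓞 K}
    (hS : a * c + ε * (b * f) = 3 * S) (hD : a * f - b * c = 3 * D) :
    elt ε m n a b * elt ε p q c f =
      elt ε (-(m * p) - 2 * ε * (n * q) - (m * c + p * a) - ε * (n * f + q * b) - 2 * S)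
        (2 * (m * q) - n * p + m * f + a * q - n * c - b * p + 2 * D)
        (3 * (m * p) + 3 * ε * (n * q) + 2 * (m * c) + 2 * (a * p) + ε * (n * f) +
          2 * ε * (b * q) + 3 * S)
        (3 * (n * p) - 3 * (m * q) - m * f + 2 * (n * c) - 2 * (a * q) + 2 * (b * p) - 3 * D) := by
  have hS' := congrArg (algebraMap (𝓞 K) K) hS
  have hD' := congrArg (algebraMap (𝓞 K) K) hD
  simp only [map_add, map_sub, map_mul, map_ofNat] at hS' hD'
  have h2' : (2 : K) ≠ 0 := two_ne_zero
  have h3' : (3 : K) ≠ 0 := three_ne_zero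
  ext <;> simp only [elt, QuaternionAlgebra.re_mul, QuaternionAlgebra.imI_mul,
    QuaternionAlgebra.imJ_mul, QuaternionAlgebra.imK_mul, map_add, map_sub, map_mul, map_neg,
    map_ofNat]
  · field_simp
    linear_combination (-4 : K) * hS'
  · field_simp
    linear_combination (4 : K) * hD'
  · field_simp
    ring
  · field_simp
    ring

variable {L : Type} [CommRing L]

/-- Submodules of `(O_K / 3)²` which describe the orders containing `𝒪₃‡`: they are stable
under `(a, b) ↦ (-u b, a)` and totally isotropic for the form `a² + u b²`. -/
structure IsAdmissible (u : L) (P : Submodule L (L × L)) : Prop where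
  isotropic : ∀ x ∈ P, ∀ y ∈ P, x.1 * y.1 + u * (x.2 * y.2) = 0
  rot_mem : ∀ x ∈ P, (-(u * x.2), x.1) ∈ P

lemma isAdmissible_bot (u : L) : IsAdmissible u (⊥ : Submodule L (L × L)) where
  isotropic x hx y hy := by
    rw [Submodule.mem_bot] at hx
    simp [hx]
  rot_mem x hx := by
    rw [Submodule.mem_bot] at hx
    simp [hx]

lemma IsAdmissible.det_eq_zero {u : L} (hu : IsUnit u) {P : Submodule L (L × L)}
    (hP : IsAdmissible u P) {x y : L × L} (hx : x ∈ P) (hy : y ∈ P) :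
    x.1 * y.2 - x.2 * y.1 = 0 := by
  have h := hP.isotropic x hx _ (hP.rot_mem y hy)
  rw [← hu.mul_right_eq_zero]
  linear_combination (-1 : L) * h

variable {π : 𝓞 K →+* L} (hker : ∀ r, π r = 0 ↔ (3 : 𝓞 K) ∣ r) {ε : (𝓞 K)ˣ}
  {P P' : Submodule L (L × L)}

omit [NumberField K] in
include hker in
lemma three_eq_zero : (3 : L) = 0 := by
  rw [← map_ofNat π 3, hker]

/-- The order containing `𝒪₃‡` attached to an admissible submodule of `(O_K / 3)²`. -/
def overOrder (hker : ∀ r, π r = 0 ↔ (3 : 𝓞 K) ∣ r) (ε : (𝓞 K)ˣ)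
    {P : Submodule L (L × L)} (hP : IsAdmissible (π ε) P) : Subring (QuatOfUnit ε) where
  carrier := {x | ∃ m n a b, (π a, π b) ∈ P ∧ x = elt ε m n a b}
  zero_mem' := ⟨0, 0, 0, 0, by simp [zero_mk_mem P], by ext <;> simp [elt]⟩
  one_mem' := ⟨2, 0, -3, 0, by simp [(hker 3).2 dvd_rfl, zero_mk_mem P], by
    ext <;> simp [elt, coe_two, coe_three]⟩
  add_mem' := by
    rintro _ _ ⟨m, n, a, b, h, rfl⟩ ⟨m', n', a', b', h', rfl⟩
    exact ⟨_, _, _, _, by simpa using P.add_mem h h', elt_add ..⟩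
  neg_mem' := by
    rintro _ ⟨m, n, a, b, h, rfl⟩
    exact ⟨-m, -n, -a, -b, by simpa using P.neg_mem h, by ext <;> simp [elt] <;> ring⟩
  mul_mem' := by
    rintro _ _ ⟨m, n, a, b, h, rfl⟩ ⟨p, q, c, f, h', rfl⟩
    have hu : IsUnit (π ε) := ε.isUnit.map π
    have h3 := three_eq_zero hker
    obtain ⟨S, hS⟩ : (3 : 𝓞 K) ∣ a * c + ε * (b * f) := by
      rw [← hker]
      simpa using hP.isotropic _ h _ h'
    obtain ⟨D, hD⟩ : (3 : 𝓞 K) ∣ a * f - b * c := by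
      rw [← hker]
      simpa using hP.det_eq_zero hu h h'
    refine ⟨_, _, _, _, ?_, elt_mul ε hS hD⟩
    have key := P.add_mem (P.add_mem (P.smul_mem (-π m) h')
      (P.smul_mem (-π n) (hP.rot_mem _ h')))
      (P.add_mem (P.smul_mem (-π p) h) (P.smul_mem (π q) (hP.rot_mem _ h)))
    convert key using 1
    ext
    · simp only [map_add, map_mul, map_ofNat, Prod.fst_add, Prod.smul_fst, smul_eq_mul]
      linear_combination (π m * π p + π ε * (π n * π q) + π m * π c + π a * π p +
        π ε * (π b * π q) + π S) * h3
    · simp only [map_add, map_sub, map_mul, map_ofNat, Prod.snd_add, Prod.smul_snd, smul_eq_mul]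
      linear_combination (π n * π p - π m * π q + π n * π c - π a * π q + π b * π p - π D) * h3

lemma elt_mem_overOrder (hP : IsAdmissible (π ε) P) {m n a b : 𝓞 K} :
    elt ε m n a b ∈ overOrder hker ε hP ↔ (π a, π b) ∈ P := by
  refine ⟨?_, fun h => ⟨m, n, a, b, h, rfl⟩⟩
  rintro ⟨m', n', a', b', h, he⟩
  obtain ⟨-, -, rfl, rfl⟩ := elt_injective he
  exact h

lemma overOrder_le_iff (hsurj : Function.Surjective π) (hP : IsAdmissible (π ε) P)
    (hP' : IsAdmissible (π ε) P') : overOrder hker ε hP ≤ overOrder hker ε hP' ↔ P ≤ P' := by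
  refine ⟨fun h => ?_, fun h => ?_⟩
  · rintro ⟨x, y⟩ hxy
    obtain ⟨a, rfl⟩ := hsurj x
    obtain ⟨b, rfl⟩ := hsurj y
    rw [← elt_mem_overOrder hker hP' (m := 0) (n := 0)]
    exact h ((elt_mem_overOrder hker hP).2 hxy)
  · rintro _ ⟨m, n, a, b, hab, rfl⟩
    exact ⟨m, n, a, b, h hab, rfl⟩

lemma elt_zero_mem_baseOrder (m n a b : 𝓞 K) : elt ε m n (3 * a) (3 * b) ∈ baseOrder ε := by
  have hs : ∀ r : 𝓞 K, algebraMap K (QuatOfUnit ε) r ∈ baseOrder ε := fun r =>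
    Subring.subset_closure (Or.inl ⟨r, rfl⟩)
  have hi : (⟨0, 1, 0, 0⟩ : QuatOfUnit ε) ∈ baseOrder ε :=
    Subring.subset_closure (Or.inr (Or.inl rfl))
  have hρ : (2 : K)⁻¹ • (1 + (⟨0, 0, 1, 0⟩ : QuatOfUnit ε)) ∈ baseOrder ε :=
    Subring.subset_closure (Or.inr (Or.inr rfl))
  set i : QuatOfUnit ε := ⟨0, 1, 0, 0⟩
  set ρ : QuatOfUnit ε := (2 : K)⁻¹ • (1 + (⟨0, 0, 1, 0⟩ : QuatOfUnit ε)) with hρd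
  have h2 : (2 : K) ≠ 0 := two_ne_zero
  have hj := sub_mem (add_mem hρ hρ) (one_mem (baseOrder ε))
  have : elt ε m n (3 * a) (3 * b) = algebraMap K (QuatOfUnit ε) m * ρ +
      algebraMap K (QuatOfUnit ε) n * (i * ρ) + algebraMap K (QuatOfUnit ε) a * (ρ + ρ - 1) +
      algebraMap K (QuatOfUnit ε) b * (i * (ρ + ρ - 1)) := by
    ext <;> simp [elt, i, hρd, coe_three] <;> field_simp <;> ring
  rw [this]
  exact add_mem (add_mem (add_mem (mul_mem (hs m) hρ) (mul_mem (hs n) (mul_mem hi hρ)))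
    (mul_mem (hs a) hj)) (mul_mem (hs b) (mul_mem hi hj))

lemma baseOrder_le_overOrder (hP : IsAdmissible (π ε) P) :
    baseOrder ε ≤ overOrder hker ε hP := by
  have h3 : π 3 = 0 := (hker 3).2 dvd_rfl
  rw [Subring.closure_le]
  rintro x (⟨r, rfl⟩ | rfl | rfl)
  · refine ⟨2 * r, 0, -3 * r, 0, by simp [h3, zero_mk_mem P], ?_⟩
    ext <;> simp [elt, coe_two, coe_three]
    ring
  · exact ⟨0, 2, 0, -3, by simp [h3, zero_mk_mem P], by
      ext <;> simp [elt, coe_two, coe_three]⟩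
  · exact ⟨1, 0, 0, 0, by simp [zero_mk_mem P], by ext <;> simp [elt]⟩

lemma baseOrder_eq : baseOrder ε = overOrder hker ε (isAdmissible_bot (π ε)) := by
  refine le_antisymm (baseOrder_le_overOrder hker _) ?_
  rintro _ ⟨m, n, a, b, h, rfl⟩
  rw [Submodule.mem_bot, Prod.mk_eq_zero, hker, hker] at h
  obtain ⟨⟨a, rfl⟩, ⟨b, rfl⟩⟩ := h
  exact elt_zero_mem_baseOrder m n a b

lemma isOrder_overOrder (hP : IsAdmissible (π ε) P) : IsOrder K (overOrder hker ε hP) := by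
  have hle := baseOrder_le_overOrder hker hP
  refine ⟨?_, ?_, ?_⟩
  · exact fun x hx => hle (Subring.subset_closure (Or.inl hx))
  · let f : (Fin 4 → 𝓞 K) →ₗ[ℤ] QuatOfUnit ε := AddMonoidHom.toIntLinearMap
      { toFun v := elt ε (v 0) (v 1) (v 2) (v 3)
        map_zero' := by ext <;> simp [elt]
        map_add' v w := (elt_add ..).symm }
    let N := AddSubgroup.toIntSubmodule (overOrder hker ε hP).toAddSubgroup
    have hN : N ≤ LinearMap.range f := by
      rintro _ ⟨m, n, a, b, -, rfl⟩
      exact ⟨![m, n, a, b], rfl⟩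
    have hfg : N.FG := by
      rw [← Submodule.map_comap_eq_of_le hN]
      exact (IsNoetherian.noetherian _).map f
    exact (Submodule.fg_iff_addSubgroup_fg N).1 hfg
  · have hmem : ∀ m n a b : 𝓞 K, elt ε m n (3 * a) (3 * b) ∈
        Submodule.span K (overOrder hker ε hP : Set (QuatOfUnit ε)) := fun m n a b =>
      Submodule.subset_span (hle (elt_zero_mem_baseOrder m n a b))
    rw [eq_top_iff]
    intro x _
    have : x = (2 * x.re) • elt ε 1 0 (3 * 0) (3 * 0) + (2 * x.imI) • elt ε 0 1 (3 * 0) (3 * 0) +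
        (x.imJ - x.re) • elt ε 0 0 (3 * 1) (3 * 0) +
        (x.imK - x.imI) • elt ε 0 0 (3 * 0) (3 * 1) := by
      ext <;> simp [elt, coe_three] <;> ring
    rw [this]
    exact add_mem (add_mem (add_mem (Submodule.smul_mem _ _ (hmem _ _ _ _))
      (Submodule.smul_mem _ _ (hmem _ _ _ _))) (Submodule.smul_mem _ _ (hmem _ _ _ _)))
      (Submodule.smul_mem _ _ (hmem _ _ _ _))

end OverOrders

section Converse

variable {K : Type} [Field K] [NumberField K] {L : Type} [CommRing L] {π : 𝓞 K →+* L}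
  (hker : ∀ r, π r = 0 ↔ (3 : 𝓞 K) ∣ r) {ε : (𝓞 K)ˣ}

lemma exists_eq_elt {O : Subring (QuatOfUnit ε)} (hO : IsOrder K O) (hle : baseOrder ε ≤ O)
    {x : QuatOfUnit ε} (hx : x ∈ O) : ∃ m n a b, x = elt ε m n a b := by
  have hi : (⟨0, 1, 0, 0⟩ : QuatOfUnit ε) ∈ O :=
    hle (Subring.subset_closure (Or.inr (Or.inl rfl)))
  have hρ : (2 : K)⁻¹ • (1 + (⟨0, 0, 1, 0⟩ : QuatOfUnit ε)) ∈ O :=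
    hle (Subring.subset_closure (Or.inr (Or.inr rfl)))
  obtain ⟨⟨t₀, h₀⟩, -⟩ := exists_trace_norm hO.2.1 hx
  obtain ⟨⟨t₁, h₁⟩, -⟩ := exists_trace_norm hO.2.1 (O.mul_mem hx hi)
  obtain ⟨⟨t₂, h₂⟩, -⟩ := exists_trace_norm hO.2.1 (O.mul_mem hx hρ)
  obtain ⟨⟨t₃, h₃⟩, -⟩ := exists_trace_norm hO.2.1 (O.mul_mem hx (O.mul_mem hi hρ))
  have hu : algebraMap (𝓞 K) K ↑ε⁻¹ * algebraMap (𝓞 K) K ↑ε = 1 := by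
    rw [← map_mul, Units.inv_mul, map_one]
  have h2 : (2 : K) ≠ 0 := two_ne_zero
  simp only [QuaternionAlgebra.re_mul, QuaternionAlgebra.imI_mul, QuaternionAlgebra.imJ_mul,
    QuaternionAlgebra.imK_mul, QuaternionAlgebra.re_smul, QuaternionAlgebra.imI_smul,
    QuaternionAlgebra.imJ_smul, QuaternionAlgebra.imK_smul, QuaternionAlgebra.re_add,
    QuaternionAlgebra.imI_add, QuaternionAlgebra.imJ_add, QuaternionAlgebra.imK_add,
    QuaternionAlgebra.re_one, QuaternionAlgebra.imI_one, QuaternionAlgebra.imJ_one,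
    QuaternionAlgebra.imK_one, smul_eq_mul] at h₁ h₂ h₃
  have e₁ : algebraMap (𝓞 K) K ↑ε⁻¹ * t₁ = -(2 * x.imI) := by
    rw [h₁]
    linear_combination (-(2 * x.imI)) * hu
  have e₃ : algebraMap (𝓞 K) K ↑ε⁻¹ * t₃ = -(x.imI + 3 * x.imK) := by
    rw [h₃]
    field_simp
    linear_combination (-(x.imI + 3 * x.imK)) * hu
  refine ⟨t₀, -(↑ε⁻¹ * t₁), -t₂ - t₀, -(↑ε⁻¹ * t₃) + 2 * (↑ε⁻¹ * t₁), ?_⟩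
  ext <;> simp only [elt, map_add, map_sub, map_neg, map_mul, map_ofNat, e₁, e₃, h₀, h₂]
  all_goals field_simp
  all_goals ring

/-- Every order containing `𝒪₃‡` comes from an admissible submodule. -/
lemma exists_overOrder (hsurj : Function.Surjective π) {O : Subring (QuatOfUnit ε)}
    (hO : IsOrder K O) (hle : baseOrder ε ≤ O) :
    ∃ (P : Submodule L (L × L)) (hP : IsAdmissible (π ε) P), O = overOrder hker ε hP := by
  have hcongr : ∀ {m n a b : 𝓞 K} (m' n' : 𝓞 K) {a' b' : 𝓞 K}, elt ε m n a b ∈ O →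
      π a = π a' → π b = π b' → elt ε m' n' a' b' ∈ O := by
    intro m n a b m' n' a' b' h ha hb
    obtain ⟨c, hc⟩ := (hker (a' - a)).1 (by rw [map_sub, ha, sub_self])
    obtain ⟨f, hf⟩ := (hker (b' - b)).1 (by rw [map_sub, hb, sub_self])
    have := O.add_mem h (hle (elt_zero_mem_baseOrder (m' - m) (n' - n) c f))
    rw [elt_add, ← hc, ← hf] at this
    simpa using this
  have hi : (⟨0, 1, 0, 0⟩ : QuatOfUnit ε) ∈ O :=
    hle (Subring.subset_closure (Or.inr (Or.inl rfl)))
  let P : Submodule L (L × L) :=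
    { carrier := {p | ∃ a b, (π a, π b) = p ∧ elt ε 0 0 a b ∈ O}
      zero_mem' := ⟨0, 0, by simp, by
        simpa using hle (elt_zero_mem_baseOrder (ε := ε) 0 0 0 0)⟩
      add_mem' := by
        rintro _ _ ⟨a, b, rfl, h⟩ ⟨c, f, rfl, h'⟩
        exact ⟨a + c, b + f, by simp, by simpa [elt_add] using O.add_mem h h'⟩
      smul_mem' := by
        rintro r _ ⟨a, b, rfl, h⟩
        obtain ⟨r, rfl⟩ := hsurj r
        refine ⟨r * a, r * b, by simp, ?_⟩
        have := O.mul_mem (hO.1 ⟨r, rfl⟩) h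
        convert this using 1
        ext <;> (simp [elt]; try ring) }
  have hnorm : ∀ {a b : 𝓞 K}, elt ε 0 0 a b ∈ O → π a ^ 2 + π ε * π b ^ 2 = 0 := by
    intro a b h
    obtain ⟨-, N, hN⟩ := exists_trace_norm hO.2.1 h
    rw [← map_pow, ← map_pow, ← map_mul, ← map_add, hker]
    refine ⟨N, RingOfIntegers.ext ?_⟩
    simp [elt] at hN
    simp [coe_three, hN]
    ring
  have hP : IsAdmissible (π ε) P :=
    { isotropic := by
        rintro _ ⟨a, b, rfl, h⟩ _ ⟨c, f, rfl, h'⟩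
        have h'' := hnorm (by simpa [elt_add] using O.add_mem h h')
        simp only [map_add] at h''
        linear_combination (-1 : L) * h'' + hnorm h + hnorm h' +
          (π a * π c + π ε * (π b * π f)) * three_eq_zero hker
      rot_mem := by
        rintro _ ⟨a, b, rfl, h⟩
        refine ⟨-(ε * b), a, by simp, ?_⟩
        have := O.mul_mem hi h
        convert this using 1
        ext <;> simp [elt]
        ring }
  refine ⟨P, hP, le_antisymm (fun x hx => ?_) ?_⟩
  · obtain ⟨m, n, a, b, rfl⟩ := exists_eq_elt hO hle hx
    exact ⟨m, n, a, b, ⟨a, b, rfl, hcongr 0 0 hx rfl rfl⟩, rfl⟩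
  · rintro _ ⟨m, n, a, b, ⟨a', b', hab, h⟩, rfl⟩
    rw [Prod.mk.injEq] at hab
    exact hcongr m n h hab.1 hab.2

end Converse

section Conjugation

variable {K : Type} [Field K] [NumberField K]

/-- The unit `j` of the quaternion algebra `(-ε, -3 / K)`. -/
def jUnit (ε : (𝓞 K)ˣ) : (QuatOfUnit ε)ˣ where
  val := ⟨0, 0, 1, 0⟩
  inv := ⟨0, 0, -3⁻¹, 0⟩
  val_inv := by ext <;> simp
  inv_val := by ext <;> simp

lemma jUnit_conj (ε : (𝓞 K)ˣ) (y : QuatOfUnit ε) :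
    (jUnit ε : QuatOfUnit ε) * y * (((jUnit ε)⁻¹ : (QuatOfUnit ε)ˣ) : QuatOfUnit ε) =
      ⟨y.re, -y.imI, y.imJ, -y.imK⟩ := by
  change (⟨0, 0, 1, 0⟩ : QuatOfUnit ε) * y * ⟨0, 0, -3⁻¹, 0⟩ = _
  ext <;> simp <;> ring

variable {L : Type} [CommRing L] {π : 𝓞 K →+* L} (hker : ∀ r, π r = 0 ↔ (3 : 𝓞 K) ∣ r)
  {ε : (𝓞 K)ˣ} {P P' : Submodule L (L × L)}

lemma isConjugate_jUnit (hP : IsAdmissible (π ε) P) (hP' : IsAdmissible (π ε) P')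
    (h : ∀ a b, (a, b) ∈ P ↔ (a, -b) ∈ P') :
    IsConjugate (jUnit ε) (overOrder hker ε hP) (overOrder hker ε hP') := by
  intro y
  rw [jUnit_conj]
  constructor
  · rintro ⟨m, n, a, b, hab, rfl⟩
    refine ⟨m, -n, a, -b, by simpa using (h _ _).1 hab, ?_⟩
    ext <;> simp [elt] <;> ring
  · rintro ⟨m, n, a, b, hab, hy⟩
    refine ⟨m, -n, a, -b, by rw [h]; simpa using hab, ?_⟩
    simp only [elt, QuaternionAlgebra.mk.injEq] at hy
    ext <;> simp [elt, ← hy.1]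
    · linear_combination -hy.2.1
    · linear_combination hy.2.2.1 - hy.1
    · linear_combination -hy.2.2.2

lemma isConjugate_one {A : Type} [Ring A] (O : Subring A) : IsConjugate 1 O O := by
  intro y
  simp

variable {d : ℕ} {sqrtd : K} (h : IsRealQuadratic K d sqrtd) {σ₀ σ₁ : K →+* ℝ}
  (hσ₁ : σ₁ sqrtd = -σ₀ sqrtd) (hε₀ : 0 < σ₀ (algebraMap (𝓞 K) K ↑ε))
  (hε₁ : 0 < σ₁ (algebraMap (𝓞 K) K ↑ε)) {x : (QuatOfUnit ε)ˣ}
  (hx : IsConjugate x (baseOrder ε) (baseOrder ε))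

include h hσ₁ hε₀ hε₁ hx hker

/-- An element normalizing `𝒪₃‡` maps `j` to `± j`. -/
lemma conj_j_eq : ∃ η : ℤ, (η = 1 ∨ η = -1) ∧
    (x : QuatOfUnit ε) * ⟨0, 0, 1, 0⟩ * ((x⁻¹ : (QuatOfUnit ε)ˣ) : QuatOfUnit ε) =
      ⟨0, 0, η, 0⟩ := by
  have hmem := (hx _).1 (Subring.subset_closure (Or.inr (Or.inr rfl)))
  rw [baseOrder_eq hker] at hmem
  obtain ⟨m, n, a, b, hab, hc⟩ := hmem
  rw [Submodule.mem_bot, Prod.mk_eq_zero, hker, hker] at hab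
  obtain ⟨⟨a, rfl⟩, ⟨b, rfl⟩⟩ := hab
  set ρ : QuatOfUnit ε := (2 : K)⁻¹ • (1 + (⟨0, 0, 1, 0⟩ : QuatOfUnit ε)) with hρ
  have hρ2 : ρ * ρ = ρ - 1 := by
    ext <;> simp [hρ] <;> norm_num
  set c : QuatOfUnit ε := x * ρ * ((x⁻¹ : (QuatOfUnit ε)ˣ) : QuatOfUnit ε) with hcd
  have hc2 : c * c = c - 1 := by
    calc c * c = x * (ρ * ρ) * ((x⁻¹ : (QuatOfUnit ε)ˣ) : QuatOfUnit ε) := by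
          simp only [hcd, mul_assoc, Units.inv_mul_cancel_left]
      _ = c - 1 := by rw [hρ2, mul_sub, sub_mul, mul_one, Units.mul_inv]
  have hj : (x : QuatOfUnit ε) * ⟨0, 0, 1, 0⟩ * ((x⁻¹ : (QuatOfUnit ε)ˣ) : QuatOfUnit ε) =
      c + c - 1 := by
    have : (⟨0, 0, 1, 0⟩ : QuatOfUnit ε) = ρ + ρ - 1 := by ext <;> simp [hρ] <;> norm_num
    rw [this, mul_sub, sub_mul, mul_one, Units.mul_inv, mul_add, add_mul]
  have e0 := congrArg QuaternionAlgebra.re hc2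
  have e1 := congrArg QuaternionAlgebra.imI hc2
  have e2 := congrArg QuaternionAlgebra.imJ hc2
  have e3 := congrArg QuaternionAlgebra.imK hc2
  simp only [QuaternionAlgebra.re_mul, QuaternionAlgebra.imI_mul, QuaternionAlgebra.imJ_mul,
    QuaternionAlgebra.imK_mul, QuaternionAlgebra.re_sub, QuaternionAlgebra.imI_sub,
    QuaternionAlgebra.imJ_sub, QuaternionAlgebra.imK_sub, QuaternionAlgebra.re_one,
    QuaternionAlgebra.imI_one, QuaternionAlgebra.imJ_one, QuaternionAlgebra.imK_one]
    at e0 e1 e2 e3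
  have hre : 2 * c.re - 1 = 0 := by
    by_contra hne
    have z1 : c.imI = 0 := (mul_eq_zero.1 (by linear_combination e1 :
      (2 * c.re - 1) * c.imI = 0)).resolve_left hne
    have z2 : c.imJ = 0 := (mul_eq_zero.1 (by linear_combination e2 :
      (2 * c.re - 1) * c.imJ = 0)).resolve_left hne
    have z3 : c.imK = 0 := (mul_eq_zero.1 (by linear_combination e3 :
      (2 * c.re - 1) * c.imK = 0)).resolve_left hne
    have := congrArg σ₀ (by linear_combination e0 + (algebraMap (𝓞 K) K ↑ε * c.imI) * z1 +
      3 * c.imJ * z2 + 3 * algebraMap (𝓞 K) K ↑ε * c.imK * z3 : c.re ^ 2 - c.re + 1 = 0)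
    simp only [map_add, map_sub, map_pow, map_one, map_zero] at this
    nlinarith [sq_nonneg (σ₀ c.re - 1 / 2)]
  have hnorm : algebraMap (𝓞 K) K ↑ε * (2 * c.imI) ^ 2 + 3 * (2 * c.imJ) ^ 2 +
      3 * algebraMap (𝓞 K) K ↑ε * (2 * c.imK) ^ 2 = 3 := by
    linear_combination (-4 : K) * e0 + (2 * c.re - 1) * hre
  have cJ : 2 * c.imJ = 2 * (a : K) + 1 := by
    have h0 := congrArg QuaternionAlgebra.re hc
    have h2 := congrArg QuaternionAlgebra.imJ hc
    simp only [elt, map_mul, map_ofNat] at h0 h2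
    linear_combination 2 * h2 - 2 * h0 + hre
  have hsq : ∀ σ : K →+* ℝ, 0 < σ (algebraMap (𝓞 K) K ↑ε) → (2 * σ a + 1) ^ 2 ≤ 1 := by
    intro σ hσ
    have := congrArg σ hnorm
    rw [cJ] at this
    simp only [map_add, map_mul, map_pow, map_one, map_ofNat] at this
    nlinarith [mul_nonneg hσ.le (sq_nonneg (2 * σ c.imI)),
      mul_nonneg hσ.le (sq_nonneg (2 * σ c.imK))]
  obtain ⟨k, rfl, -⟩ := h.exists_int_of_sq_le hσ₁ a (by nlinarith [hsq σ₀ hε₀])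
    (by nlinarith [hsq σ₁ hε₁])
  have hk := hsq σ₀ hε₀
  simp only [map_intCast] at hk cJ
  have hk' : (2 * k + 1) ^ 2 ≤ 1 := by exact_mod_cast hk
  have hη : 2 * k + 1 = 1 ∨ 2 * k + 1 = -1 := by
    have : -1 ≤ k := by nlinarith
    have : k ≤ 0 := by nlinarith
    lia
  have hη2 : (2 * (k : K) + 1) ^ 2 = 1 := by
    have : (2 * k + 1) ^ 2 = 1 := by rcases hη with hη | hη <;> rw [hη] <;> norm_num
    exact_mod_cast congrArg (Int.cast : ℤ → K) this
  have hz : c.imI = 0 ∧ c.imK = 0 := by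
    rw [cJ, hη2] at hnorm
    have := congrArg σ₀ hnorm
    simp only [map_add, map_mul, map_pow, map_one, map_ofNat] at this
    have h1 : 0 ≤ σ₀ c.imI ^ 2 := sq_nonneg _
    have h2 : 0 ≤ σ₀ c.imK ^ 2 := sq_nonneg _
    have h3 := mul_nonneg hε₀.le h1
    have h4 := mul_nonneg hε₀.le h2
    have h5 : σ₀ (algebraMap (𝓞 K) K ↑ε) * σ₀ c.imI ^ 2 = 0 := by nlinarith
    have h6 : σ₀ (algebraMap (𝓞 K) K ↑ε) * σ₀ c.imK ^ 2 = 0 := by nlinarith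
    simpa [hε₀.ne'] using And.intro h5 h6
  refine ⟨2 * k + 1, hη, ?_⟩
  rw [hj]
  ext
  · simpa [two_mul] using hre
  · simp [hz.1]
  · simpa [two_mul] using cJ
  · simp [hz.2]

/-- An element normalizing `𝒪₃‡` acts on the orders containing it through `(a, b) ↦ (a, ± b)`. -/
lemma exists_sign (hsurj : Function.Surjective π) : ∃ δ : L, (δ = 1 ∨ δ = -1) ∧
    ∀ {P P' : Submodule L (L × L)} (hP : IsAdmissible (π ε) P) (hP' : IsAdmissible (π ε) P'),
      IsConjugate x (overOrder hker ε hP) (overOrder hker ε hP') →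
      ∀ a b, (a, b) ∈ P → (a, δ * b) ∈ P' := by
  obtain ⟨η, hη, hj⟩ := conj_j_eq hker h hσ₁ hε₀ hε₁ hx
  have hηK : (η : K) * η = 1 := by rcases hη with rfl | rfl <;> norm_num
  have hmem := (hx _).1 (Subring.subset_closure (Or.inr (Or.inl rfl)))
  rw [baseOrder_eq hker] at hmem
  obtain ⟨m, n, a, b, hab, hy⟩ := hmem
  rw [Submodule.mem_bot, Prod.mk_eq_zero, hker, hker] at hab
  obtain ⟨⟨a, rfl⟩, ⟨b, rfl⟩⟩ := hab
  set i : QuatOfUnit ε := ⟨0, 1, 0, 0⟩ with hi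
  set j : QuatOfUnit ε := ⟨0, 0, 1, 0⟩ with hjd
  set X' : QuatOfUnit ε := ((x⁻¹ : (QuatOfUnit ε)ˣ) : QuatOfUnit ε) with hX'
  set y : QuatOfUnit ε := x * i * X' with hyd
  have hmul : ∀ z w : QuatOfUnit ε, x * (z * w) * X' = (x * z * X') * (x * w * X') := by
    intro z w
    simp only [hX', mul_assoc, Units.inv_mul_cancel_left]
  have hyy : y * y = -algebraMap K (QuatOfUnit ε) (algebraMap (𝓞 K) K ε) := by
    have : i * i = -algebraMap K (QuatOfUnit ε) (algebraMap (𝓞 K) K ε) := by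
      ext <;> simp [hi]
    rw [hyd, ← hmul, this, mul_neg, neg_mul, ← Algebra.commutes, mul_assoc, Units.mul_inv, mul_one]
  have hyj : y * (⟨0, 0, η, 0⟩ : QuatOfUnit ε) = -(⟨0, 0, η, 0⟩ * y) := by
    have : i * j = -(j * i) := by ext <;> simp [hi, hjd]
    rw [← hj, hyd, ← hmul, ← hmul, this, mul_neg, neg_mul]
  have e0 := congrArg QuaternionAlgebra.imJ hyj
  have e2 := congrArg QuaternionAlgebra.re hyj
  simp only [QuaternionAlgebra.re_mul, QuaternionAlgebra.imJ_mul, QuaternionAlgebra.re_neg,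
    QuaternionAlgebra.imJ_neg] at e0 e2
  have y0 : y.re = 0 := by linear_combination (η / 2 : K) * e0 - y.re * hηK
  have y2 : y.imJ = 0 := by linear_combination (-η / 6 : K) * e2 - y.imJ * hηK
  have en := congrArg QuaternionAlgebra.re hyy
  simp only [QuaternionAlgebra.re_mul, QuaternionAlgebra.re_neg,
    QuaternionAlgebra.algebraMap_eq, y0, y2] at en
  have hε : algebraMap (𝓞 K) K ε ≠ 0 := fun h0 => by simp [h0] at hε₀
  have hn : (2 * y.imI) ^ 2 + 3 * (2 * y.imK) ^ 2 = 4 := by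
    apply mul_left_cancel₀ hε
    linear_combination (-4 : K) * en
  have y1 : 2 * y.imI = n := by
    rw [hy]
    simp only [elt]
    ring
  have y3 : 2 * y.imK = ((n + 2 * b : 𝓞 K) : K) := by
    rw [hy]
    simp only [elt, map_mul, map_add, map_ofNat]
    ring
  rw [y1, y3] at hn
  have hsq : ∀ σ : K →+* ℝ, σ n ^ 2 + 3 * σ (n + 2 * b : 𝓞 K) ^ 2 = 4 := by
    intro σ
    have := congrArg σ hn
    simpa only [map_add σ (_ ^ 2), map_mul σ 3, map_pow, map_ofNat] using this
  obtain ⟨k, hk, -⟩ := h.exists_int_of_sq_le hσ₁ n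
    (by nlinarith [hsq σ₀, sq_nonneg (σ₀ (n + 2 * b : 𝓞 K))])
    (by nlinarith [hsq σ₁, sq_nonneg (σ₁ (n + 2 * b : 𝓞 K))])
  obtain ⟨t, ht, -⟩ := h.exists_int_of_sq_le hσ₁ (n + 2 * b)
    (by nlinarith [hsq σ₀, sq_nonneg (σ₀ n)]) (by nlinarith [hsq σ₁, sq_nonneg (σ₁ n)])
  have hkt : k ^ 2 + 3 * t ^ 2 = 4 := by
    have := hsq σ₀
    rw [ht, hk] at this
    simp only [map_intCast] at this
    exact_mod_cast this
  obtain ⟨l, r, hl, hlr⟩ : ∃ l r : ℤ, 2 * l = k + 3 * t ∧ (l = 1 + 3 * r ∨ l = -1 + 3 * r) := by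
    have h1 : k ≤ 2 := by nlinarith
    have h2 : -2 ≤ k := by nlinarith
    have h3 : t ≤ 1 := by nlinarith
    have h4 : -1 ≤ t := by nlinarith
    interval_cases k <;> interval_cases t <;> simp at hkt
    · exact ⟨-1, 0, by norm_num⟩
    · exact ⟨-2, -1, by norm_num⟩
    · exact ⟨1, 0, by norm_num⟩
    · exact ⟨-1, 0, by norm_num⟩
    · exact ⟨2, 1, by norm_num⟩
    · exact ⟨1, 0, by norm_num⟩
  have hπl : π l = 1 ∨ π l = -1 := by
    have h3 : (3 : L) = 0 := three_eq_zero hker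
    rw [map_intCast]
    rcases hlr with rfl | rfl
    · left
      simp [h3]
    · right
      simp [h3]
  have hconj : ∀ a b : 𝓞 K, x * elt ε 0 0 a b * X' = elt ε 0 (-(η * (b * t))) (η * a)
      (η * (l * b)) := by
    intro a b
    have h1 : elt ε 0 0 a b = algebraMap K (QuatOfUnit ε) (a / 3) * j +
        algebraMap K (QuatOfUnit ε) (b / 3) * (i * j) := by
      ext <;> simp [elt, hi, hjd]
    have h2 : ∀ r z, x * (algebraMap K (QuatOfUnit ε) r * z) * X' =
        algebraMap K (QuatOfUnit ε) r * (x * z * X') := by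
      intro r z
      rw [← mul_assoc, ← Algebra.commutes, mul_assoc, mul_assoc, mul_assoc]
    have h3 : y = ⟨0, k / 2, 0, t / 2⟩ := by
      rw [hk] at y1
      rw [ht] at y3
      ext
      · exact y0
      · simp at y1 ⊢
        linear_combination y1 / 2
      · exact y2
      · simp at y3 ⊢
        linear_combination y3 / 2
    have hlK : 2 * (l : K) = k + 3 * t := by exact_mod_cast congrArg (Int.cast : ℤ → K) hl
    rw [h1, mul_add, add_mul, h2, h2, hmul, hj, ← hyd, h3]
    ext <;> simp [elt]
    · ring
    · ring
    · linear_combination (-(η * b) / 6 : K) * hlK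
  refine ⟨π l, hπl, ?_⟩
  intro P P' hP hP' hPP' u v huv
  obtain ⟨a, rfl⟩ := hsurj u
  obtain ⟨b, rfl⟩ := hsurj v
  have := (hPP' _).1 ((elt_mem_overOrder hker hP (m := 0) (n := 0)).2 huv)
  rw [← hX', hconj, elt_mem_overOrder] at this
  rcases hη with rfl | rfl
  · simpa using this
  · simpa using P'.neg_mem this

end Conjugation

section Counting

variable {K : Type} [Field K] [NumberField K] {L : Type} [CommRing L] {π : 𝓞 K →+* L}
  {ε : (𝓞 K)ˣ} {d : ℕ} {sqrtd : K} {σ₀ σ₁ : K →+* ℝ}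

lemma alephNum_eq_and_bethNum_eq (h : IsRealQuadratic K d sqrtd)
    (hσ₁ : σ₁ sqrtd = -σ₀ sqrtd) (hε₀ : 0 < σ₀ (algebraMap (𝓞 K) K ↑ε))
    (hε₁ : 0 < σ₁ (algebraMap (𝓞 K) K ↑ε)) (hker : ∀ r, π r = 0 ↔ (3 : 𝓞 K) ∣ r)
    (hsurj : Function.Surjective π) {ι κ : Type*} {P : ι → Submodule L (L × L)}
    (hP : ∀ i, IsAdmissible (π ε) (P i))
    (hle : ∀ Q, IsAdmissible (π ε) Q → ∃ i, Q ≤ P i) (hinj : ∀ i j, P i ≤ P j → i = j)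
    {τ : ι → ι} (hτ : ∀ i a b, (a, b) ∈ P (τ i) ↔ (a, -b) ∈ P i) {f : ι → κ}
    (hf : Function.Surjective f) (hfτ : ∀ i j, f i = f j ↔ j = i ∨ j = τ i) :
    alephNum K (baseOrder ε) = Nat.card ι ∧ bethNum K (baseOrder ε) = Nat.card κ := by
  have hmax : ∀ i, IsMaximalOrder K (overOrder hker ε (hP i)) := by
    refine fun i => ⟨isOrder_overOrder hker (hP i), fun O hO hiO => ?_⟩
    obtain ⟨Q, hQ, rfl⟩ := exists_overOrder hker hsurj hO
      ((baseOrder_le_overOrder hker (hP i)).trans hiO)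
    rw [overOrder_le_iff hker hsurj] at hiO
    obtain ⟨j, hj⟩ := hle Q hQ
    obtain rfl := hinj i j (hiO.trans hj)
    congr 1
    exact le_antisymm hj hiO
  let g : ι → {O : Subring (QuatOfUnit ε) // IsMaximalOrder K O ∧ baseOrder ε ≤ O} := fun i =>
    ⟨overOrder hker ε (hP i), hmax i, baseOrder_le_overOrder hker (hP i)⟩
  have hg : Function.Bijective g := by
    refine ⟨fun i j hij => ?_, ?_⟩
    · have := (Subtype.ext_iff.1 hij).le
      rw [overOrder_le_iff hker hsurj] at this
      exact hinj i j this
    · rintro ⟨O, hO, hbO⟩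
      obtain ⟨Q, hQ, rfl⟩ := exists_overOrder hker hsurj hO.1 hbO
      obtain ⟨i, hi⟩ := hle Q hQ
      exact ⟨i, Subtype.ext (hO.2 _ (hmax i).1 ((overOrder_le_iff hker hsurj hQ (hP i)).2 hi))⟩
  have hrel : ∀ i j, (∃ x : (QuatOfUnit ε)ˣ, IsConjugate x (baseOrder ε) (baseOrder ε) ∧
      IsConjugate x (g i).1 (g j).1) ↔ f i = f j := by
    intro i j
    rw [hfτ]
    constructor
    · rintro ⟨x, hx, hxij⟩
      obtain ⟨δ, hδ, hδP⟩ := exists_sign hker h hσ₁ hε₀ hε₁ hx hsurj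
      have hab := hδP (hP i) (hP j) hxij
      rcases hδ with rfl | rfl
      · exact Or.inl (hinj i j (fun x hx => by simpa using hab _ _ hx)).symm
      · refine Or.inr (hinj _ _ fun x hx => ?_).symm
        simpa using hab _ _ ((hτ _ _ _).1 hx)
    · rintro (rfl | rfl)
      · exact ⟨1, isConjugate_one _, isConjugate_one _⟩
      · refine ⟨jUnit ε, ?_, isConjugate_jUnit hker (hP i) (hP _) fun a b => by simp [hτ]⟩
        rw [baseOrder_eq hker]
        exact isConjugate_jUnit hker (isAdmissible_bot _) (isAdmissible_bot _) fun a b => by simp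
  refine ⟨(Nat.card_eq_of_bijective g hg).symm, ?_⟩
  let e := Equiv.ofBijective g hg
  have hrel' := fun O O' => hrel (e.symm O) (e.symm O')
  have he : ∀ O, g (e.symm O) = O := e.apply_symm_apply
  simp only [he] at hrel'
  refine Nat.card_eq_of_bijective (Quot.lift (fun O => f (e.symm O)) fun O O' hOO' =>
    (hrel' O O').1 hOO') ⟨?_, ?_⟩
  · rintro ⟨O⟩ ⟨O'⟩ hOO'
    exact Quot.sound ((hrel' O O').2 hOO')
  · intro k
    obtain ⟨i, rfl⟩ := hf k
    exact ⟨Quot.mk _ (g i), congrArg f (e.symm_apply_apply i)⟩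

end Counting

section Classification

section Line

variable {L : Type} [CommRing L]

/-- The line `a = c b` in `L²`. -/
def line (c : L) : Submodule L (L × L) :=
  LinearMap.ker (LinearMap.fst L L L - c • LinearMap.snd L L L)

lemma mem_line {c : L} {p : L × L} : p ∈ line c ↔ p.1 = c * p.2 := by
  simp [line, sub_eq_zero]

lemma isAdmissible_line {u c : L} (hc : c * c = -u) : IsAdmissible u (line c) where
  isotropic x hx y hy := by
    rw [mem_line] at hx hy
    rw [hx, hy]
    linear_combination x.2 * y.2 * hc
  rot_mem x hx := by
    rw [mem_line] at hx ⊢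
    rw [hx]
    linear_combination -x.2 * hc

lemma line_le_line_iff {c c' : L} : line c ≤ line c' ↔ c = c' := by
  refine ⟨fun h => ?_, fun h => h ▸ le_rfl⟩
  simpa [mem_line] using h (show (c, 1) ∈ line c by simp [mem_line])

lemma IsAdmissible.le_line {u c : L} {Q : Submodule L (L × L)} (hQ : IsAdmissible u Q)
    (hu : IsUnit u) (hc : c * c = -u) {p : L × L} (hp : p ∈ Q) (hpc : p.1 = c * p.2)
    (hreg : ∀ x, p.2 * x = 0 → x = 0) : Q ≤ line c := by
  intro x hx
  have hcu : IsUnit c := isUnit_of_mul_isUnit_left (hc ▸ hu.neg)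
  rw [mem_line, ← sub_eq_zero]
  apply hreg
  rw [← hcu.mul_right_eq_zero]
  have := hQ.isotropic p hp x hx
  rw [hpc] at this
  linear_combination this - p.2 * x.2 * hc

lemma IsAdmissible.eq_zero_of_map_eq_one {u : L} {Q : Submodule L (L × L)}
    (hQ : IsAdmissible u Q) {φ : L →+* ZMod 3} (hφ : φ u = 1) {p : L × L} (hp : p ∈ Q) :
    φ p.1 = 0 ∧ φ p.2 = 0 := by
  have := congrArg φ (hQ.isotropic p hp p hp)
  simp only [map_add, map_mul, map_zero, hφ, one_mul] at this
  generalize φ p.1 = x at *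
  generalize φ p.2 = y at *
  revert x y
  decide

lemma IsAdmissible.map_eq_or_map_eq_neg {u : L} {Q : Submodule L (L × L)}
    (hQ : IsAdmissible u Q) {φ : L →+* ZMod 3} (hφ : φ u = -1) :
    (∀ p ∈ Q, φ p.1 = φ p.2) ∨ (∀ p ∈ Q, φ p.1 = -φ p.2) := by
  have key : ∀ p ∈ Q, ∀ q ∈ Q, φ p.1 * φ q.1 - φ p.2 * φ q.2 = 0 := by
    intro p hp q hq
    have := congrArg φ (hQ.isotropic p hp q hq)
    simp only [map_add, map_mul, map_zero, hφ] at this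
    linear_combination this
  have hfin : ∀ x y x' y' : ZMod 3, x * x - y * y = 0 → x' * x' - y' * y' = 0 →
      x * x' - y * y' = 0 → x ≠ y → x' = -y' := by decide
  by_contra! hcon
  obtain ⟨⟨p, hp, hpne⟩, ⟨q, hq, hqne⟩⟩ := hcon
  exact hqne (hfin _ _ _ _ (key p hp p hp) (key q hq q hq) (key p hp q hq) hpne)

end Line

variable {δ : ZMod 3} {u : QuadraticAlgebra (ZMod 3) δ 0}
  {Q : Submodule (QuadraticAlgebra (ZMod 3) δ 0)
    (QuadraticAlgebra (ZMod 3) δ 0 × QuadraticAlgebra (ZMod 3) δ 0)}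

/-- Pairs of elements of the maximal ideal `(√d)` of `(ℤ/3)[√d]` when `3 ∣ d`. -/
def nilpotentPairs (hδ : δ = 0) : Submodule (QuadraticAlgebra (ZMod 3) δ 0)
    (QuadraticAlgebra (ZMod 3) δ 0 × QuadraticAlgebra (ZMod 3) δ 0) where
  carrier := {p | p.1.re = 0 ∧ p.2.re = 0}
  zero_mem' := by simp
  add_mem' := by
    rintro x y ⟨h1, h2⟩ ⟨h3, h4⟩
    simp [h1, h2, h3, h4]
  smul_mem' := by
    rintro r x ⟨h1, h2⟩
    simp [h1, h2, hδ]

lemma isAdmissible_nilpotentPairs (hδ : δ = 0) : IsAdmissible u (nilpotentPairs hδ) where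
  isotropic := by
    rintro x ⟨h1, h2⟩ y ⟨h3, h4⟩
    ext <;> simp [h1, h2, h3, h4, hδ]
  rot_mem := by
    rintro x ⟨h1, h2⟩
    exact ⟨by simp [h2, hδ], h1⟩

lemma IsAdmissible.le_nilpotentPairs (hQ : IsAdmissible u Q) (hδ : δ = 0) (hu : u.re = 1) :
    Q ≤ nilpotentPairs hδ := by
  intro p hp
  have := congrArg QuadraticAlgebra.re (hQ.isotropic p hp p hp)
  simp [hδ, hu] at this
  change p.1.re = 0 ∧ p.2.re = 0
  generalize p.1.re = x at *
  generalize p.2.re = y at *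
  revert x y
  decide

lemma exists_sq_eq_neg_of_zero (hδ : δ = 0) (hu : u.re = -1) :
    ∃ c : QuadraticAlgebra (ZMod 3) δ 0, c * c = -u ∧ c.re = 1 := by
  refine ⟨⟨1, u.im⟩, ?_, rfl⟩
  ext
  · simp [hδ, hu]
  · simp
    generalize u.im = x
    revert x
    decide

lemma IsAdmissible.le_of_zero (hQ : IsAdmissible u Q) (hδ : δ = 0) (hu : IsUnit u)
    {c : QuadraticAlgebra (ZMod 3) δ 0} (hc : c * c = -u) (hcre : c.re = 1) :
    Q ≤ line c ∨ Q ≤ line (-c) ∨ Q ≤ nilpotentPairs hδ := by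
  by_cases hnil : Q ≤ nilpotentPairs hδ
  · exact Or.inr (Or.inr hnil)
  obtain ⟨p, hp, hpn⟩ := SetLike.not_le_iff_exists.1 hnil
  have h0 : (p.1 - c * p.2) * (p.1 + c * p.2) = 0 := by
    linear_combination hQ.isotropic p hp p hp - p.2 * p.2 * hc
  have hreg : ∀ x y : QuadraticAlgebra (ZMod 3) δ 0, x.re ≠ 0 → x * y = 0 → y = 0 := by
    intro x y hx hxy
    have e0 := congrArg QuadraticAlgebra.re hxy
    have e1 := congrArg QuadraticAlgebra.im hxy
    simp [hδ, hx] at e0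
    simp [e0, hx] at e1
    ext <;> simp [e0, e1]
  have hre := congrArg QuadraticAlgebra.re h0
  simp [hδ, hcre] at hre
  have hb : p.2.re ≠ 0 := by
    intro hb
    refine hpn ⟨?_, hb⟩
    simpa [hb] using hre
  by_cases hne : p.1.re - p.2.re = 0
  · refine Or.inl (hQ.le_line hu hc hp (sub_eq_zero.1 (hreg (p.1 + c * p.2) _ ?_ ?_))
      fun x => hreg _ x hb)
    · have hfin : ∀ y : ZMod 3, y ≠ 0 → ¬y + y = 0 := by decide
      simpa [hδ, hcre, sub_eq_zero.1 hne] using hfin _ hb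
    · rw [mul_comm, h0]
  · refine Or.inr (Or.inl (hQ.le_line hu (by rw [neg_mul_neg, hc]) hp ?_ fun x => hreg _ x hb))
    rw [neg_mul, ← add_eq_zero_iff_eq_neg]
    refine hreg _ _ ?_ h0
    simpa [hδ, hcre] using hne

/-- The reduction modulo `3` followed by `√d ↦ s`, where `s ^ 2 = d`. -/
def evalHom (s : ZMod 3) (hs : s * s = δ) : QuadraticAlgebra (ZMod 3) δ 0 →+* ZMod 3 where
  toFun x := x.re + s * x.im
  map_one' := by simp [QuadraticAlgebra.re_one, QuadraticAlgebra.im_one]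
  map_zero' := by simp [QuadraticAlgebra.re_zero, QuadraticAlgebra.im_zero]
  map_add' x y := by
    simp
    ring
  map_mul' x y := by
    simp [← hs]
    ring

lemma evalHom_apply (s : ZMod 3) (hs : s * s = δ) (x : QuadraticAlgebra (ZMod 3) δ 0) :
    evalHom s hs x = x.re + s * x.im := rfl

lemma IsAdmissible.eq_bot_of_one (hQ : IsAdmissible u Q) (hδ : δ = 1) (hu : u = 1) : Q = ⊥ := by
  rw [eq_bot_iff]
  intro p hp
  have h1 := hQ.eq_zero_of_map_eq_one (φ := evalHom 1 (by simp [hδ])) (by simp [hu]) hp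
  have h2 := hQ.eq_zero_of_map_eq_one (φ := evalHom (-1) (by simp [hδ])) (by simp [hu]) hp
  simp only [evalHom_apply] at h1 h2
  have hfin : ∀ x y : ZMod 3, x + 1 * y = 0 → x + -1 * y = 0 → x = 0 ∧ y = 0 := by decide
  rw [Submodule.mem_bot]
  obtain ⟨h3, h4⟩ := hfin _ _ h1.1 h2.1
  obtain ⟨h5, h6⟩ := hfin _ _ h1.2 h2.2
  ext <;> simp [*]

lemma IsAdmissible.le_of_one (hQ : IsAdmissible u Q) (hδ : δ = 1) (hu : u = -1) :
    Q ≤ line 1 ∨ Q ≤ line (-1) ∨ Q ≤ line ⟨0, 1⟩ ∨ Q ≤ line (-⟨0, 1⟩) := by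
  have hfin : ∀ a b c d : ZMod 3, (a + 1 * b = c + 1 * d → a + -1 * b = c + -1 * d →
      a = c ∧ b = d) := by decide
  have h1 := hQ.map_eq_or_map_eq_neg (φ := evalHom 1 (by simp [hδ])) (by simp [hu])
  have h2 := hQ.map_eq_or_map_eq_neg (φ := evalHom (-1) (by simp [hδ])) (by simp [hu])
  simp only [evalHom_apply] at h1 h2
  rcases h1 with h1 | h1 <;> rcases h2 with h2 | h2
  · refine Or.inl fun p hp => mem_line.2 ?_
    have := hfin _ _ _ _ (h1 p hp) (h2 p hp)
    ext <;> simp [this]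
  · refine Or.inr (Or.inr (Or.inl fun p hp => mem_line.2 ?_))
    have := hfin p.1.re p.1.im p.2.im p.2.re (by linear_combination h1 p hp)
      (by linear_combination h2 p hp)
    ext <;> simp [this, hδ]
  · refine Or.inr (Or.inr (Or.inr fun p hp => mem_line.2 ?_))
    have := hfin p.1.re p.1.im (-p.2.im) (-p.2.re) (by linear_combination h1 p hp)
      (by linear_combination h2 p hp)
    ext <;> simp [this, hδ]
  · refine Or.inr (Or.inl fun p hp => mem_line.2 ?_)
    have := hfin p.1.re p.1.im (-p.2.re) (-p.2.im) (by linear_combination h1 p hp)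
      (by linear_combination h2 p hp)
    ext <;> simp [this]

lemma eq_zero_or_eq_zero_of_two (hδ : δ = 2) {x y : QuadraticAlgebra (ZMod 3) δ 0}
    (hxy : x * y = 0) : x = 0 ∨ y = 0 := by
  have hfin : ∀ a b c d : ZMod 3, a * c + 2 * b * d = 0 → a * d + b * c = 0 →
      (a = 0 ∧ b = 0) ∨ (c = 0 ∧ d = 0) := by decide
  have e0 := congrArg QuadraticAlgebra.re hxy
  have e1 := congrArg QuadraticAlgebra.im hxy
  simp [hδ] at e0 e1
  simp only [QuadraticAlgebra.ext_iff]
  exact hfin _ _ _ _ e0 e1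

lemma exists_sq_eq_neg_of_two (hδ : δ = 2) (hu : u.re ^ 2 - 2 * u.im ^ 2 = 1) :
    ∃ c : QuadraticAlgebra (ZMod 3) δ 0, c * c = -u := by
  have hfin : ∀ a b : ZMod 3, a ^ 2 - 2 * b ^ 2 = 1 →
      ∃ x y : ZMod 3, x * x + 2 * y * y = -a ∧ x * y + y * x = -b := by decide
  obtain ⟨x, y, h1, h2⟩ := hfin _ _ hu
  exact ⟨⟨x, y⟩, by ext <;> simp [hδ, h1, h2]⟩

lemma IsAdmissible.le_of_two (hQ : IsAdmissible u Q) (hδ : δ = 2) (hu : IsUnit u)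
    {c : QuadraticAlgebra (ZMod 3) δ 0} (hc : c * c = -u) :
    Q ≤ line c ∨ Q ≤ line (-c) := by
  by_cases hbot : ∀ p ∈ Q, p.2 = 0
  · refine Or.inl fun p hp => ?_
    have := hQ.isotropic p hp p hp
    rw [hbot p hp] at this
    rw [mem_line, hbot p hp, mul_zero]
    exact or_self_iff.1 (eq_zero_or_eq_zero_of_two hδ (by simpa using this))
  push Not at hbot
  obtain ⟨p, hp, hb⟩ := hbot
  have hreg : ∀ x, p.2 * x = 0 → x = 0 := fun x hx =>
    (eq_zero_or_eq_zero_of_two hδ hx).resolve_left hb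
  have h0 : (p.1 - c * p.2) * (p.1 + c * p.2) = 0 := by
    linear_combination hQ.isotropic p hp p hp - p.2 * p.2 * hc
  rcases eq_zero_or_eq_zero_of_two hδ h0 with h | h
  · exact Or.inl (hQ.le_line hu hc hp (sub_eq_zero.1 h) hreg)
  · refine Or.inr (hQ.le_line hu (by rw [neg_mul_neg, hc]) hp ?_ hreg)
    rw [neg_mul, ← add_eq_zero_iff_eq_neg, h]

end Classification

section Cases

variable {K : Type} [Field K] [NumberField K] {ε : (𝓞 K)ˣ} {d : ℕ} {sqrtd : K} {σ₀ σ₁ : K →+* ℝ}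
  (h : IsRealQuadratic K d sqrtd) (hσ₁ : σ₁ sqrtd = -σ₀ sqrtd)
  (hε₀ : 0 < σ₀ (algebraMap (𝓞 K) K ↑ε)) (hε₁ : 0 < σ₁ (algebraMap (𝓞 K) K ↑ε))
  {δ : ZMod 3} {π : 𝓞 K →+* QuadraticAlgebra (ZMod 3) δ 0}
  (hker : ∀ r, π r = 0 ↔ (3 : 𝓞 K) ∣ r) (hsurj : Function.Surjective π)

include h hσ₁ hε₀ hε₁ hker hsurj

lemma alephNum_bethNum_of_zero_of_one (hδ : δ = 0) (hu : (π ε).re = 1) :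
    alephNum K (baseOrder ε) = 1 ∧ bethNum K (baseOrder ε) = 1 := by
  simpa using alephNum_eq_and_bethNum_eq (ι := Unit) (κ := Unit) h hσ₁ hε₀ hε₁ hker hsurj
    (P := fun _ => nilpotentPairs hδ) (fun _ => isAdmissible_nilpotentPairs hδ)
    (fun Q hQ => ⟨(), hQ.le_nilpotentPairs hδ hu⟩) (fun _ _ _ => rfl) (τ := id)
    (fun _ a b => by simp [nilpotentPairs]) (f := id) Function.surjective_id (by simp)

lemma alephNum_bethNum_of_zero_of_neg_one (hδ : δ = 0) (hu : (π ε).re = -1) :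
    alephNum K (baseOrder ε) = 3 ∧ bethNum K (baseOrder ε) = 2 := by
  obtain ⟨c, hc, hcre⟩ := exists_sq_eq_neg_of_zero hδ hu
  have hc' : -c * -c = -π ε := by rw [neg_mul_neg, hc]
  have hmem : ∀ a b, (a, b) ∈ nilpotentPairs hδ ↔ a.re = 0 ∧ b.re = 0 := fun a b => Iff.rfl
  have hne : c ≠ -c := by
    intro hcc
    have := congrArg QuadraticAlgebra.re hcc
    rw [QuadraticAlgebra.re_neg, hcre] at this
    exact absurd this (by decide)
  have h1 : ∀ c : QuadraticAlgebra (ZMod 3) δ 0, c.re ≠ 0 → ¬line c ≤ nilpotentPairs hδ := by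
    intro c hc hle
    exact hc ((hmem _ _).1 (hle (show (c, 1) ∈ line c by simp [mem_line]))).1
  have h2 : ∀ c : QuadraticAlgebra (ZMod 3) δ 0, ¬nilpotentPairs hδ ≤ line c := by
    intro c hle
    have := hle ((hmem ⟨0, 1⟩ 0).2 (by simp [QuadraticAlgebra.re_zero]))
    rw [mem_line] at this
    simpa using congrArg QuadraticAlgebra.im this
  simpa using alephNum_eq_and_bethNum_eq (ι := Fin 3) (κ := Fin 2) h hσ₁ hε₀ hε₁ hker hsurj
    (P := ![line c, line (-c), nilpotentPairs hδ])
    (by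
      intro i
      fin_cases i
      exacts [isAdmissible_line hc, isAdmissible_line hc', isAdmissible_nilpotentPairs hδ])
    (fun Q hQ => by
      rcases hQ.le_of_zero hδ (ε.isUnit.map π) hc hcre with h | h | h
      exacts [⟨0, h⟩, ⟨1, h⟩, ⟨2, h⟩])
    (by
      intro i j
      fin_cases i <;> fin_cases j <;> simp [line_le_line_iff, hne, hne.symm, h1, h2, hcre])
    (τ := ![1, 0, 2])
    (by
      intro i a b
      fin_cases i <;> simp [mem_line, hmem])
    (f := ![0, 0, 1]) (by decide) (by decide)

lemma alephNum_bethNum_of_one_of_one (hδ : δ = 1) (hu : π ε = 1) :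
    alephNum K (baseOrder ε) = 1 ∧ bethNum K (baseOrder ε) = 1 := by
  simpa using alephNum_eq_and_bethNum_eq (ι := Unit) (κ := Unit) h hσ₁ hε₀ hε₁ hker hsurj
    (P := fun _ => ⊥) (fun _ => isAdmissible_bot _)
    (fun Q hQ => ⟨(), (hQ.eq_bot_of_one hδ hu).le⟩) (fun _ _ _ => rfl) (τ := id)
    (fun _ a b => by simp) (f := id) Function.surjective_id (by simp)

lemma alephNum_bethNum_of_one_of_neg_one (hδ : δ = 1) (hu : π ε = -1) :
    alephNum K (baseOrder ε) = 4 ∧ bethNum K (baseOrder ε) = 2 := by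
  have ht : (⟨0, 1⟩ : QuadraticAlgebra (ZMod 3) δ 0) * ⟨0, 1⟩ = -π ε := by
    rw [hu]
    ext <;> simp [hδ, QuadraticAlgebra.re_one, QuadraticAlgebra.im_one]
  simpa using alephNum_eq_and_bethNum_eq (ι := Fin 4) (κ := Fin 2) h hσ₁ hε₀ hε₁ hker hsurj
    (P := ![line 1, line (-1), line ⟨0, 1⟩, line (-⟨0, 1⟩)])
    (by
      intro i
      fin_cases i
      exacts [isAdmissible_line (by simp [hu]), isAdmissible_line (by simp [hu]),
        isAdmissible_line ht, isAdmissible_line (by rw [neg_mul_neg, ht])])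
    (fun Q hQ => by
      rcases hQ.le_of_one hδ hu with h | h | h | h
      exacts [⟨0, h⟩, ⟨1, h⟩, ⟨2, h⟩, ⟨3, h⟩])
    (by
      intro i j
      fin_cases i <;> fin_cases j <;>
        simp [line_le_line_iff, QuadraticAlgebra.ext_iff, QuadraticAlgebra.re_one,
          QuadraticAlgebra.im_one] <;> decide)
    (τ := ![1, 0, 3, 2])
    (by
      generalize (⟨0, 1⟩ : QuadraticAlgebra (ZMod 3) δ 0) = t
      intro i a b
      fin_cases i <;> simp [mem_line])
    (f := ![0, 0, 1, 1]) (by decide) (by decide)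

lemma alephNum_bethNum_of_two (hδ : δ = 2) (hu : (π ε).re ^ 2 - 2 * (π ε).im ^ 2 = 1) :
    alephNum K (baseOrder ε) = 2 ∧ bethNum K (baseOrder ε) = 1 := by
  obtain ⟨c, hc⟩ := exists_sq_eq_neg_of_two hδ hu
  have hne : c ≠ -c := by
    intro hcc
    have h3 : (3 : QuadraticAlgebra (ZMod 3) δ 0) = 0 := three_eq_zero hker
    have hc0 : c = 0 := by linear_combination c * h3 - hcc
    rw [hc0, mul_zero, eq_comm, neg_eq_zero] at hc
    rw [hc] at hu
    simp [QuadraticAlgebra.re_zero, QuadraticAlgebra.im_zero] at hu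
  simpa using alephNum_eq_and_bethNum_eq (ι := Fin 2) (κ := Unit) h hσ₁ hε₀ hε₁ hker hsurj
    (P := ![line c, line (-c)])
    (by
      intro i
      fin_cases i
      exacts [isAdmissible_line hc, isAdmissible_line (by rw [neg_mul_neg, hc])])
    (fun Q hQ => by
      rcases hQ.le_of_two hδ (ε.isUnit.map π) hc with h | h
      exacts [⟨0, h⟩, ⟨1, h⟩])
    (by
      intro i j
      fin_cases i <;> fin_cases j <;> simp [line_le_line_iff, hne, hne.symm])
    (τ := ![1, 0])
    (by
      intro i a b
      fin_cases i <;> simp [mem_line])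
    (f := fun _ => ()) (fun _ => ⟨0, rfl⟩) (by decide)

end Cases

section Unit

variable {K : Type} [Field K] [NumberField K] {d : ℕ} {sqrtd : K} {σ₀ σ₁ : K →+* ℝ}

/-- The half-integral coordinates of an element of norm one. -/
lemma IsRealQuadratic.exists_int_of_norm_eq_one (h : IsRealQuadratic K d sqrtd) (σ₀ : K →+* ℝ)
    {r : 𝓞 K} (hr : Algebra.norm ℚ (r : K) = 1) :
    ∃ m n : ℤ, (2 * r : K) = m + n * sqrtd ∧ m ^ 2 - d * n ^ 2 = 4 := by
  obtain ⟨m, n, -, hmn, -⟩ := h.exists_int σ₀ r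
  refine ⟨m, n, hmn, ?_⟩
  have hr' : (r : K) = ((m / 2 : ℚ) : K) + ((n / 2 : ℚ) : K) * sqrtd := by
    push_cast
    linear_combination hmn / 2
  rw [hr', h.norm_eq] at hr
  have : (m ^ 2 - d * n ^ 2 : ℚ) = 4 := by linear_combination 4 * hr
  exact_mod_cast this

lemma IsRealQuadratic.conj_pos (h : IsRealQuadratic K d sqrtd) (hσ₁ : σ₁ sqrtd = -σ₀ sqrtd)
    {r : K} {m n : ℤ} (hmn : 2 * r = m + n * sqrtd) (hN : m ^ 2 - d * n ^ 2 = 4)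
    (hr : 0 < σ₀ r) : 0 < σ₁ r := by
  have hsq : σ₀ sqrtd ^ 2 = d := by rw [← map_pow, h.sq_eq, map_natCast]
  have e0 : 2 * σ₀ r = m + n * σ₀ sqrtd := by
    simpa [map_ofNat σ₀ 2] using congrArg σ₀ hmn
  have e1 : 2 * σ₁ r = m - n * σ₀ sqrtd := by
    simpa [hσ₁, sub_eq_add_neg, map_ofNat σ₁ 2] using congrArg σ₁ hmn
  have hN' : (m ^ 2 - d * n ^ 2 : ℝ) = 4 := by exact_mod_cast hN
  have : σ₀ r * σ₁ r = 1 := by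
    linear_combination (2 * σ₁ r * e0 + (m + n * σ₀ sqrtd) * e1 + hN' - n ^ 2 * hsq) / 4
  exact pos_of_mul_pos_right (this ▸ one_pos) hr.le

lemma three_dvd_of_mem {R : Type} [CommRing R] {q : Ideal R} (hq : q ≠ ⊤) (h3 : (3 : R) ∈ q)
    {a : ℤ} (ha : (a : R) ∈ q) : (3 : ℤ) ∣ a := by
  by_contra hd
  obtain ⟨u, v, huv⟩ := (Int.prime_three.coprime_iff_not_dvd).2 hd
  refine hq (q.eq_top_iff_one.2 ?_)
  have := congrArg (Int.cast : ℤ → R) huv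
  push_cast at this
  rw [← this]
  exact add_mem (q.mul_mem_left _ h3) (q.mul_mem_left _ ha)

/-- In the ramified case, a congruence modulo the prime above `3` is a congruence of rational
coordinates. -/
lemma IsRealQuadratic.three_dvd_of_sub_mem (h : IsRealQuadratic K d sqrtd) (hd : 3 ∣ d)
    {q : Ideal (𝓞 K)} (hq : q.IsPrime) (h3 : (3 : 𝓞 K) ∈ q) {r : 𝓞 K} {m n c : ℤ}
    (hmn : (2 * r : K) = m + n * sqrtd) (hr : r - c ∈ q) : (3 : ℤ) ∣ m - 2 * c := by
  obtain ⟨s, hs⟩ := h.exists_sqrt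
  have hsq : s ^ 2 = d := by
    apply RingOfIntegers.ext
    simpa [hs] using h.sq_eq
  have hmem : s ∈ q := by
    refine hq.mem_of_pow_mem 2 ?_
    obtain ⟨e, rfl⟩ := hd
    rw [hsq, Nat.cast_mul]
    exact q.mul_mem_right _ (by exact_mod_cast h3)
  have hmn' : 2 * r = m + n * s := by
    apply RingOfIntegers.ext
    simpa [hs, map_ofNat (algebraMap (𝓞 K) K) 2] using hmn
  refine three_dvd_of_mem hq.ne_top h3 ?_
  have : ((m - 2 * c : ℤ) : 𝓞 K) = 2 * (r - c) - n * s := by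
    push_cast
    linear_combination -hmn'
  rw [this]
  exact sub_mem (q.mul_mem_left _ hr) (q.mul_mem_left _ hmem)

end Unit

/-- **`ℵ(𝒪₃‡)` and `ℶ(𝒪₃‡)` for the order `𝒪₃‡ = O_F[i,(1+j)/2] ⊂ (−ε,−3 / F)`** -/
theorem aleph_beth_O3
    (d : ℕ) (hd6 : 6 ≤ d) (hdsf : Squarefree d)
    (sqrtd : F) (hsqrtd : sqrtd ^ 2 = (d : F))
    (hgen : Algebra.adjoin ℚ {sqrtd} = ⊤)
    (σ₀ : F →+* ℝ) (hσ₀ : 0 < σ₀ sqrtd)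
    -- `ε` is the fundamental unit of `F`: the smallest unit greater than `1`
    (ε : (𝓞 F)ˣ) (hε : 1 < σ₀ (algebraMap (𝓞 F) F ↑ε))
    (hεfund : ∀ u : (𝓞 F)ˣ, 1 < σ₀ (algebraMap (𝓞 F) F ↑u) →
      σ₀ (algebraMap (𝓞 F) F ↑ε) ≤ σ₀ (algebraMap (𝓞 F) F ↑u))
    (hnorm : Algebra.norm ℚ (algebraMap (𝓞 F) F ↑ε) = 1) :
    -- `𝒪₃‡ = O_F[i, (1+j)/2] ⊆ H = (−ε, −3 / F)`
    let 𝒪 : Subring ℍ[F, -(algebraMap (𝓞 F) F ↑ε), -3] :=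
      Subring.closure
        (scalarSet F ℍ[F, -(algebraMap (𝓞 F) F ↑ε), -3] ∪
          {⟨0, 1, 0, 0⟩,
            (2 : F)⁻¹ • (1 + (⟨0, 0, 1, 0⟩ : ℍ[F, -(algebraMap (𝓞 F) F ↑ε), -3]))})
    -- case `3 ∣ d`, `ε ≡ 1 (mod 𝔮)`, `𝔮` the unique prime of `O_F` above `3`
    (∀ 𝔮 : Ideal (𝓞 F), 𝔮.IsPrime → (3 : 𝓞 F) ∈ 𝔮 →
      3 ∣ d → (↑ε - 1 : 𝓞 F) ∈ 𝔮 → alephNum F 𝒪 = 1 ∧ bethNum F 𝒪 = 1) ∧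
    -- case `3 ∣ d`, `ε ≡ −1 (mod 𝔮)`
    (∀ 𝔮 : Ideal (𝓞 F), 𝔮.IsPrime → (3 : 𝓞 F) ∈ 𝔮 →
      3 ∣ d → (↑ε + 1 : 𝓞 F) ∈ 𝔮 → alephNum F 𝒪 = 3 ∧ bethNum F 𝒪 = 2) ∧
    -- case `d ≡ 1 (mod 3)`, `ε ≡ 1 (mod 3 O_F)`
    (d % 3 = 1 → (↑ε - 1 : 𝓞 F) ∈ Ideal.span {(3 : 𝓞 F)} →
      alephNum F 𝒪 = 1 ∧ bethNum F 𝒪 = 1) ∧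
    -- case `d ≡ 1 (mod 3)`, `ε ≡ −1 (mod 3 O_F)`
    (d % 3 = 1 → (↑ε + 1 : 𝓞 F) ∈ Ideal.span {(3 : 𝓞 F)} →
      alephNum F 𝒪 = 4 ∧ bethNum F 𝒪 = 2) ∧
    -- case `d ≡ 2 (mod 3)`
    (d % 3 = 2 → alephNum F 𝒪 = 2 ∧ bethNum F 𝒪 = 1) := by
  intro 𝒪
  have h : IsRealQuadratic F d sqrtd := ⟨hd6, hdsf, hsqrtd, hgen⟩
  obtain ⟨σ₁, hσ₁⟩ := h.exists_conj σ₀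
  obtain ⟨m, n, hmn, hN⟩ := h.exists_int_of_norm_eq_one σ₀ hnorm
  have hε₀ : 0 < σ₀ (algebraMap (𝓞 F) F ↑ε) := one_pos.trans hε
  have hε₁ := h.conj_pos hσ₁ hmn hN hε₀
  obtain ⟨π, hπ, hsurj, hker⟩ := h.exists_reduction σ₀
  have hπε := hπ _ _ _ hmn
  have hd : (d : ZMod 3) = (d % 3 : ℕ) := (ZMod.natCast_mod d 3).symm
  have hre : ∀ c : ℤ, (3 : ℤ) ∣ m - 2 * c → (π ε).re = c := by
    intro c hc
    replace hc := (ZMod.intCast_zmod_eq_zero_iff_dvd _ 3).2 hc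
    push_cast at hc
    rw [hπε]
    have h3 : (3 : ZMod 3) = 0 := by decide
    linear_combination 2 * hc + c * h3
  refine ⟨fun 𝔮 h𝔮 h3 h3d hmem => ?_, fun 𝔮 h𝔮 h3 h3d hmem => ?_, fun hd1 hmem => ?_,
    fun hd1 hmem => ?_, fun hd2 => ?_⟩
  · have := hre 1 (h.three_dvd_of_sub_mem h3d h𝔮 h3 hmn (by simpa using hmem))
    exact alephNum_bethNum_of_zero_of_one h hσ₁ hε₀ hε₁ hker hsurj
      ((ZMod.natCast_eq_zero_iff d 3).2 h3d) (by simpa using this)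
  · have := hre (-1) (h.three_dvd_of_sub_mem h3d h𝔮 h3 hmn (by simpa using hmem))
    exact alephNum_bethNum_of_zero_of_neg_one h hσ₁ hε₀ hε₁ hker hsurj
      ((ZMod.natCast_eq_zero_iff d 3).2 h3d) (by simpa using this)
  · have := (hker _).2 (Ideal.mem_span_singleton.1 hmem)
    rw [map_sub, map_one, sub_eq_zero] at this
    exact alephNum_bethNum_of_one_of_one h hσ₁ hε₀ hε₁ hker hsurj (by simp [hd, hd1]) this
  · have := (hker _).2 (Ideal.mem_span_singleton.1 hmem)
    rw [map_add, map_one, add_eq_zero_iff_eq_neg] at this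
    exact alephNum_bethNum_of_one_of_neg_one h hσ₁ hε₀ hε₁ hker hsurj (by simp [hd, hd1]) this
  · have hδ : (d : ZMod 3) = 2 := by simp [hd, hd2]
    refine alephNum_bethNum_of_two h hσ₁ hε₀ hε₁ hker hsurj hδ ?_
    have hN' := congrArg (Int.cast : ℤ → ZMod 3) hN
    push_cast at hN'
    rw [hδ] at hN'
    rw [hπε]
    have h3 : (3 : ZMod 3) = 0 := by decide
    linear_combination 4 * hN' + 5 * h3

end QuatPaper
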